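/- There exists a function F : ℂ → ℂ, meromorphic on all of ℂ, with F(s) = Σ_{m₁,m₂ ≥ 1} 1/(m₁·m₂·(m₁+m₂))^s for every s with Re(s) > 1 (sum over all pairs of positive integers), such that for every even positive integer m: F is analytic at s = −m, F(−m) = 0, F′(−m) = 0, and ((2π)^{3m}/(m!)³) · F″(−m) = ((−1)^{m/2}/3) · [ Σ_{j=0}^{m} C(m+j, j)·C(2m−j, m−j)·ζ(1+m+j)·ζ(1+2m−j)·(1 + 2·(−1)^j) + (1/2)·C(3m+1, 2m+1)·ζ(3m+2) ], where ζ(w) denotes the Riemann zeta function at the integer w and C(a,b) the binomial coefficient. -/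

import Mathlib

open Complex Filter

section BernoulliConvolution

open PowerSeries Finset

/-- The homogeneous polynomials of degree `n` in the Bernoulli power series and `X`. -/
def bernoulliHomogeneous (n : ℕ) : Submodule ℚ (PowerSeries ℚ) :=
  Submodule.span ℚ {f | ∃ i j : ℕ, i + j = n ∧ f = bernoulliPowerSeries ℚ ^ i * X ^ j}

/-- The power series `X ^ (m + 1) * Y` where `Y` is the `m`-th Hasse derivative of
`1 / (exp X - 1)`. -/
def bernoulliHasse (m : ℕ) : PowerSeries ℚ :=
  PowerSeries.mk fun k => (∏ l ∈ range m, ((k : ℚ) - (l + 1)) / (l + 1)) *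
    (bernoulli k / (k.factorial : ℚ))

lemma X_mul_derivative_bernoulliPowerSeries :
    X * d⁄dX ℚ (bernoulliPowerSeries ℚ) =
      bernoulliPowerSeries ℚ - (X * bernoulliPowerSeries ℚ + bernoulliPowerSeries ℚ ^ 2) := by
  have h := bernoulliPowerSeries_mul_exp_sub_one ℚ
  have h2 := congrArg (d⁄dX ℚ) h
  have h3 : d⁄dX ℚ (exp ℚ) = exp ℚ := by
    ext n
    simp [coeff_derivative, coeff_exp, Nat.factorial_succ]
    field_simp
  simp only [Derivation.leibniz, map_sub, h3, smul_eq_mul, derivative_X,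
    Derivation.map_one_eq_zero, sub_zero] at h2
  linear_combination (bernoulliPowerSeries ℚ) * h2 - (d⁄dX ℚ (bernoulliPowerSeries ℚ)) * h -
    bernoulliPowerSeries ℚ * h

lemma coeff_bernoulliPowerSeries_pow_mul (i : ℕ) :
    coeff (i + 1) (bernoulliPowerSeries ℚ ^ i *
      (X * bernoulliPowerSeries ℚ + bernoulliPowerSeries ℚ ^ 2)) = 0 := by
  have h : bernoulliPowerSeries ℚ ^ i *
      (X * bernoulliPowerSeries ℚ + bernoulliPowerSeries ℚ ^ 2) =
      bernoulliPowerSeries ℚ ^ (i + 1) -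
        X * (bernoulliPowerSeries ℚ ^ i * d⁄dX ℚ (bernoulliPowerSeries ℚ)) := by
    linear_combination (bernoulliPowerSeries ℚ ^ i) * X_mul_derivative_bernoulliPowerSeries
  have h2 : d⁄dX ℚ (bernoulliPowerSeries ℚ ^ (i + 1)) =
      ((i : ℚ) + 1) • (bernoulliPowerSeries ℚ ^ i * d⁄dX ℚ (bernoulliPowerSeries ℚ)) := by
    rw [Derivation.leibniz_pow]
    simp [add_smul, Nat.cast_smul_eq_nsmul]
  have h3 := congrArg (coeff i) h2
  rw [coeff_derivative, map_smul, smul_eq_mul] at h3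
  rw [h, map_sub, coeff_succ_X_mul]
  have : (i : ℚ) + 1 ≠ 0 := by positivity
  rw [sub_eq_zero]
  apply mul_left_cancel₀ this
  rw [← h3]; ring

lemma bernoulliHomogeneous_mul_mem {a b : ℕ} {f g : PowerSeries ℚ}
    (hf : f ∈ bernoulliHomogeneous a) (hg : g ∈ bernoulliHomogeneous b) :
    f * g ∈ bernoulliHomogeneous (a + b) := by
  have h := Submodule.mul_mem_mul hf hg
  rw [bernoulliHomogeneous, bernoulliHomogeneous, Submodule.span_mul_span] at h
  refine Submodule.span_mono ?_ h
  rintro _ ⟨_, ⟨i, j, hij, rfl⟩, _, ⟨k, l, hkl, rfl⟩, rfl⟩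
  exact ⟨i + k, j + l, by omega, by simp only [pow_add]; ring⟩

lemma bernoulliHomogeneous_mem (i j : ℕ) :
    bernoulliPowerSeries ℚ ^ i * X ^ j ∈ bernoulliHomogeneous (i + j) :=
  Submodule.subset_span ⟨i, j, rfl, rfl⟩

lemma coeff_mul_of_mem_bernoulliHomogeneous {n : ℕ} {f : PowerSeries ℚ}
    (hf : f ∈ bernoulliHomogeneous n) :
    coeff (n + 1) (f * (X * bernoulliPowerSeries ℚ + bernoulliPowerSeries ℚ ^ 2)) = 0 := by
  induction hf using Submodule.span_induction with
  | mem f hf =>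
    obtain ⟨i, j, rfl, rfl⟩ := hf
    rw [show bernoulliPowerSeries ℚ ^ i * X ^ j *
      (X * bernoulliPowerSeries ℚ + bernoulliPowerSeries ℚ ^ 2) = X ^ j *
      (bernoulliPowerSeries ℚ ^ i * (X * bernoulliPowerSeries ℚ + bernoulliPowerSeries ℚ ^ 2)) by
      ring, show i + j + 1 = (i + 1) + j by ring, coeff_X_pow_mul]
    exact coeff_bernoulliPowerSeries_pow_mul i
  | zero => simp
  | add f g _ _ hf hg => rw [add_mul, map_add, hf, hg, add_zero]
  | smul c f _ hf => rw [smul_mul_assoc, map_smul, hf, smul_zero]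

lemma euler_mem_bernoulliHomogeneous {n : ℕ} {f : PowerSeries ℚ}
    (hf : f ∈ bernoulliHomogeneous n) :
    X * d⁄dX ℚ f - (n : ℚ) • f ∈ bernoulliHomogeneous (n + 1) := by
  induction hf using Submodule.span_induction with
  | mem f hf =>
    obtain ⟨i, j, rfl, rfl⟩ := hf
    have : X * d⁄dX ℚ (bernoulliPowerSeries ℚ ^ i * X ^ j) -
        ((i + j : ℕ) : ℚ) • (bernoulliPowerSeries ℚ ^ i * X ^ j) =
        (-(i : ℚ)) • (bernoulliPowerSeries ℚ ^ i * X ^ (j + 1)) +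
        (-(i : ℚ)) • (bernoulliPowerSeries ℚ ^ (i + 1) * X ^ j) := by
      have hE := X_mul_derivative_bernoulliPowerSeries
      rw [Derivation.leibniz, Derivation.leibniz_pow, Derivation.leibniz_pow, derivative_X]
      simp only [smul_eq_mul, nsmul_eq_mul, PowerSeries.smul_eq_C_mul, map_neg, map_natCast,
        Nat.cast_add, mul_one, map_add]
      rcases i with _ | i <;> rcases j with _ | j
      · simp
      · simp; ring
      · simp only [Nat.cast_zero, Nat.add_sub_cancel, Nat.cast_succ, pow_zero, zero_mul]
        linear_combination ((i : PowerSeries ℚ) + 1) * bernoulliPowerSeries ℚ ^ i * hE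
      · simp only [Nat.add_sub_cancel, Nat.cast_succ]
        linear_combination ((i : PowerSeries ℚ) + 1) * X ^ (j + 1) * bernoulliPowerSeries ℚ ^ i * hE
    rw [this]
    refine Submodule.add_mem _ (Submodule.smul_mem _ _ ?_) (Submodule.smul_mem _ _ ?_)
    · exact Submodule.subset_span ⟨i, j + 1, by omega, rfl⟩
    · exact Submodule.subset_span ⟨i + 1, j, by omega, rfl⟩
  | zero => simp
  | add f g _ _ hf hg =>
    convert Submodule.add_mem _ hf hg using 1
    rw [map_add, smul_add]; ring
  | smul c f _ hf =>
    convert Submodule.smul_mem _ c hf using 1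
    rw [Derivation.map_smul, smul_sub, mul_smul_comm, smul_comm c]

lemma bernoulliHasse_succ (m : ℕ) :
    bernoulliHasse (m + 1) = ((m : ℚ) + 1)⁻¹ •
      (X * d⁄dX ℚ (bernoulliHasse m) - ((m : ℚ) + 1) • bernoulliHasse m) := by
  ext k
  rw [map_smul, map_sub, map_smul, smul_eq_mul, smul_eq_mul]
  have hX : coeff k (X * d⁄dX ℚ (bernoulliHasse m)) = k * coeff k (bernoulliHasse m) := by
    cases k with
    | zero => simp
    | succ k => rw [coeff_succ_X_mul, coeff_derivative]; push_cast; ring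
  rw [hX]
  simp only [bernoulliHasse, coeff_mk, prod_range_succ]
  have : (m : ℚ) + 1 ≠ 0 := by positivity
  field_simp

lemma bernoulliHasse_succ_eq_mul (m : ℕ) :
    ∃ f ∈ bernoulliHomogeneous m, bernoulliHasse (m + 1) =
      f * (X * bernoulliPowerSeries ℚ + bernoulliPowerSeries ℚ ^ 2) := by
  have hE := X_mul_derivative_bernoulliPowerSeries
  induction m with
  | zero =>
    refine ⟨(-1 : ℚ) • (bernoulliPowerSeries ℚ ^ 0 * X ^ 0),
      Submodule.smul_mem _ _ (bernoulliHomogeneous_mem 0 0), ?_⟩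
    have h0 : bernoulliHasse 0 = bernoulliPowerSeries ℚ := by
      ext k; simp [bernoulliHasse, bernoulliPowerSeries]
    rw [bernoulliHasse_succ, h0, hE]
    simp
  | succ m ih =>
    obtain ⟨f, hf, hw⟩ := ih
    refine ⟨((m : ℚ) + 2)⁻¹ • ((X * d⁄dX ℚ f - (m : ℚ) • f) -
      f * (bernoulliPowerSeries ℚ ^ 0 * X ^ 1) -
      (2 : ℚ) • (f * (bernoulliPowerSeries ℚ ^ 1 * X ^ 0))), ?_, ?_⟩
    · refine Submodule.smul_mem _ _ (Submodule.sub_mem _ (Submodule.sub_mem _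
        (euler_mem_bernoulliHomogeneous hf) ?_) (Submodule.smul_mem _ _ ?_))
      · exact bernoulliHomogeneous_mul_mem hf (bernoulliHomogeneous_mem 0 1)
      · exact bernoulliHomogeneous_mul_mem hf (bernoulliHomogeneous_mem 1 0)
    · rw [bernoulliHasse_succ, hw, smul_mul_assoc]
      push_cast
      congr 1
      · ring
      · rw [Derivation.leibniz, map_add, Derivation.leibniz, Derivation.leibniz_pow, derivative_X]
        simp only [smul_eq_mul, nsmul_eq_mul, PowerSeries.smul_eq_C_mul, map_natCast, map_add,
          map_one, map_ofNat]
        push_cast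
        simp only [pow_one, pow_zero, mul_one, one_mul]
        linear_combination (f * X + 2 * f * bernoulliPowerSeries ℚ) * hE

lemma coeff_bernoulliHasse_pow_three (m : ℕ) (hm : 0 < m) :
    coeff (3 * m + 2) (bernoulliHasse m ^ 3) = 0 := by
  obtain ⟨n, rfl⟩ : ∃ n, m = n + 1 := ⟨m - 1, by omega⟩
  obtain ⟨f, hf, hw⟩ := bernoulliHasse_succ_eq_mul n
  have hP : X * bernoulliPowerSeries ℚ + bernoulliPowerSeries ℚ ^ 2 ∈ bernoulliHomogeneous 2 := by
    refine Submodule.add_mem _ ?_ ?_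
    · exact Submodule.subset_span ⟨1, 1, rfl, by ring⟩
    · exact Submodule.subset_span ⟨2, 0, rfl, by ring⟩
  have h := coeff_mul_of_mem_bernoulliHomogeneous (bernoulliHomogeneous_mul_mem
    (bernoulliHomogeneous_mul_mem (bernoulliHomogeneous_mul_mem
    (bernoulliHomogeneous_mul_mem hf hf) hf) hP) hP)
  rw [hw, ← h]
  congr 2 <;> ring

lemma coeff_bernoulliHasse_zero (m : ℕ) : coeff 0 (bernoulliHasse m) = (-1) ^ m := by
  simp only [bernoulliHasse, coeff_mk, Nat.cast_zero, zero_sub, bernoulli_zero, Nat.factorial_zero,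
    Nat.cast_one, div_one, mul_one]
  rw [prod_congr rfl (g := fun _ => (-1 : ℚ)), prod_const, card_range]
  intro l _
  have : (l : ℚ) + 1 ≠ 0 := by positivity
  field_simp

lemma coeff_bernoulliHasse_of_le {m k : ℕ} (hk : 0 < k) (hkm : k ≤ m) :
    coeff k (bernoulliHasse m) = 0 := by
  simp only [bernoulliHasse, coeff_mk]
  rw [prod_eq_zero (i := k - 1) (mem_range.2 (by omega)), zero_mul]
  rw [Nat.cast_sub hk]; simp

lemma prod_sub_div_eq_choose {n m : ℕ} (h : m ≤ n) :
    ∏ l ∈ range m, ((n : ℚ) - l) / (l + 1) = n.choose m := by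
  induction m with
  | zero => simp
  | succ m ih =>
    rw [prod_range_succ, ih (by omega)]
    have h1 := congrArg (Nat.cast (R := ℚ)) (Nat.choose_succ_right_eq n m)
    rw [Nat.cast_mul, Nat.cast_mul, Nat.cast_sub (by omega)] at h1
    push_cast at h1
    have : (m : ℚ) + 1 ≠ 0 := by positivity
    field_simp
    linarith

lemma coeff_bernoulliHasse_add (m j : ℕ) :
    coeff (m + 1 + j) (bernoulliHasse m) =
      ((m + j).choose j : ℚ) * (bernoulli (m + 1 + j) / ((m + 1 + j).factorial : ℚ)) := by
  simp only [bernoulliHasse, coeff_mk]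
  rw [← Nat.choose_symm_add, ← prod_sub_div_eq_choose (n := m + j) (by omega)]
  congr 1
  refine prod_congr rfl fun l _ => ?_
  push_cast; ring

/-- A convolution identity for Bernoulli numbers. -/
lemma sum_choose_mul_bernoulli (m : ℕ) (hm : 0 < m) (he : Even m) :
    ∑ p ∈ antidiagonal m, (((m + p.1).choose p.1 : ℚ) *
      (bernoulli (m + 1 + p.1) / ((m + 1 + p.1).factorial : ℚ))) *
      (((m + p.2).choose p.2 : ℚ) *
      (bernoulli (m + 1 + p.2) / ((m + 1 + p.2).factorial : ℚ))) =
    - (((3 * m + 1).choose (2 * m + 1) : ℚ) *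
      (bernoulli (3 * m + 2) / ((3 * m + 2).factorial : ℚ))) := by
  set r : PowerSeries ℚ := PowerSeries.mk fun j => ((m + j).choose j : ℚ) *
    (bernoulli (m + 1 + j) / ((m + 1 + j).factorial : ℚ)) with hr
  have hw : bernoulliHasse m = 1 + X ^ (m + 1) * r := by
    ext k
    rw [map_add, coeff_X_pow_mul', coeff_one]
    split_ifs with h1 h2 h2
    · omega
    · rw [h1, coeff_bernoulliHasse_zero, he.neg_one_pow, add_zero]
    · obtain ⟨j, rfl⟩ := Nat.exists_eq_add_of_le h2
      rw [coeff_bernoulliHasse_add, hr, coeff_mk, Nat.add_sub_cancel_left, zero_add]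
    · rw [coeff_bernoulliHasse_of_le (by omega) (by omega), zero_add]
  have h3 := coeff_bernoulliHasse_pow_three m hm
  have h4 : bernoulliHasse m ^ 3 = 1 + (3 : ℚ) • (X ^ (m + 1) * r) +
      (3 : ℚ) • (X ^ (2 * m + 2) * (r * r)) + X ^ (3 * m + 3) * (r * r * r) := by
    rw [hw]
    simp only [PowerSeries.smul_eq_C_mul, map_ofNat]
    ring
  rw [h4, map_add, map_add, map_add, map_smul, map_smul, coeff_one, if_neg (by omega),
    coeff_X_pow_mul', coeff_X_pow_mul', coeff_X_pow_mul', if_pos (by omega), if_pos (by omega),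
    if_neg (by omega), show 3 * m + 2 - (m + 1) = 2 * m + 1 by omega,
    show 3 * m + 2 - (2 * m + 2) = m by omega, coeff_mul] at h3
  simp only [hr, coeff_mk, smul_eq_mul] at h3
  rw [show m + (2 * m + 1) = 3 * m + 1 by ring, show m + 1 + (2 * m + 1) = 3 * m + 2 by ring] at h3
  linarith

end BernoulliConvolution

section ZetaConvolution

open Finset

lemma riemannZeta_nat_eq_bernoulli {n : ℕ} (hn : n ≠ 0) (he : Even n) :
    riemannZeta (n : ℂ) = -(1 / 2) * (2 * Real.pi * I) ^ n *
      ((bernoulli n / (n.factorial : ℚ) : ℚ) : ℂ) := by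
  obtain ⟨k, rfl⟩ := he.two_dvd
  have hk : k ≠ 0 := by omega
  obtain ⟨l, rfl⟩ : ∃ l, k = l + 1 := ⟨k - 1, by omega⟩
  have h := riemannZeta_two_mul_nat hk
  push_cast at h ⊢
  rw [h, show 2 * (l + 1) - 1 = 2 * l + 1 by omega, mul_pow, mul_pow, pow_mul I, I_sq]
  ring

/-- The summands of the zeta convolution sum. -/
noncomputable def zetaConvTerm (m : ℕ) (p : ℕ × ℕ) : ℂ :=
  (((m + p.1).choose p.1 : ℂ) * riemannZeta ((1 + m + p.1 : ℕ) : ℂ)) *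
    (((m + p.2).choose p.2 : ℂ) * riemannZeta ((1 + m + p.2 : ℕ) : ℂ))

lemma sum_zetaConvTerm_odd (m : ℕ) (hm : 0 < m) (he : Even m) :
    ∑ p ∈ antidiagonal m, zetaConvTerm m p * ((1 - (-1) ^ p.1) / 2) =
      (1 / 2) * ((3 * m + 1).choose (2 * m + 1) : ℂ) * riemannZeta ((3 * m + 2 : ℕ) : ℂ) := by
  have h := congrArg (fun q : ℚ => (1 / 4) * (2 * Real.pi * I) ^ (3 * m + 2) * (q : ℂ))
    (sum_choose_mul_bernoulli m hm he)
  rw [riemannZeta_nat_eq_bernoulli (n := 3 * m + 2) (by omega) (by simp [parity_simps, he])]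
  trans (1 / 4) * (2 * Real.pi * I) ^ (3 * m + 2) *
    ((-(((3 * m + 1).choose (2 * m + 1) : ℚ) *
      (bernoulli (3 * m + 2) / ((3 * m + 2).factorial : ℚ))) : ℚ) : ℂ)
  · refine Eq.trans ?_ h
    rw [Rat.cast_sum, mul_sum]
    refine sum_congr rfl fun p hp => ?_
    rw [HasAntidiagonal.mem_antidiagonal] at hp
    rcases Nat.even_or_odd p.1 with h1 | h1
    · have h2 : bernoulli (m + 1 + p.1) = 0 :=
        bernoulli_eq_zero_of_odd (by simp [parity_simps, he, h1]) (by omega)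
      rw [h1.neg_one_pow, h2]
      simp
    · have h2 : Odd p.2 := by
        rcases Nat.even_or_odd p.2 with h2 | h2
        · rw [← hp, Nat.even_add] at he
          exact absurd (he.2 h2) (Nat.not_even_iff_odd.2 h1)
        · exact h2
      rw [h1.neg_one_pow, zetaConvTerm, add_comm 1 m,
        riemannZeta_nat_eq_bernoulli (n := m + 1 + p.1) (by omega) (by
          have := Nat.not_even_iff_odd.2 h1
          simp [parity_simps, he, this]),
        riemannZeta_nat_eq_bernoulli (n := m + 1 + p.2) (by omega) (by
          have := Nat.not_even_iff_odd.2 h2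
          simp [parity_simps, he, this]),
        show 3 * m + 2 = (m + 1 + p.1) + (m + 1 + p.2) by omega, pow_add]
      push_cast
      ring
  · push_cast
    ring

lemma sum_zetaConvTerm_even (m n : ℕ) (h : m = 2 * n) :
    ∑ p ∈ antidiagonal m, zetaConvTerm m p * ((1 + (-1) ^ p.1) / 2) =
      ∑ p ∈ antidiagonal n, zetaConvTerm m (2 * p.1, 2 * p.2) := by
  symm
  refine sum_of_injOn (fun p : ℕ × ℕ => (2 * p.1, 2 * p.2)) ?_ ?_ ?_ ?_
  · rintro ⟨a, b⟩ _ ⟨c, d⟩ _ hh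
    simp only [Prod.mk.injEq] at hh ⊢
    omega
  · rintro ⟨a, b⟩ hab
    simp only [mem_coe, HasAntidiagonal.mem_antidiagonal] at hab ⊢
    omega
  · rintro ⟨a, b⟩ hab hn
    rw [HasAntidiagonal.mem_antidiagonal] at hab
    rcases Nat.even_or_odd a with h1 | h1
    · exfalso
      apply hn
      obtain ⟨c, rfl⟩ := h1.two_dvd
      dsimp only at hab
      refine ⟨(c, n - c), ?_, ?_⟩
      · simp only [mem_coe, HasAntidiagonal.mem_antidiagonal]; omega
      · exact Prod.ext rfl (by dsimp only; omega)
    · simp [h1.neg_one_pow]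
  · rintro ⟨a, b⟩ _
    simp

lemma sum_range_zetaConv (m n : ℕ) (hm : 0 < m) (h : m = 2 * n) :
    (∑ j ∈ range (m + 1), (Nat.choose (m + j) j : ℂ) * (Nat.choose (2 * m - j) (m - j) : ℂ) *
      riemannZeta ((1 + m + j : ℕ) : ℂ) * riemannZeta ((1 + 2 * m - j : ℕ) : ℂ) *
      (1 + 2 * (-1 : ℂ) ^ j)) +
      (1 / 2) * (Nat.choose (3 * m + 1) (2 * m + 1) : ℂ) * riemannZeta ((3 * m + 2 : ℕ) : ℂ) =
    3 * ∑ p ∈ antidiagonal n, zetaConvTerm m (2 * p.1, 2 * p.2) := by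
  rw [← sum_zetaConvTerm_even m n h, ← sum_zetaConvTerm_odd m hm (by simp [h]),
    Finset.Nat.sum_antidiagonal_eq_sum_range_succ_mk, Finset.Nat.sum_antidiagonal_eq_sum_range_succ_mk,
    mul_sum, ← sum_add_distrib]
  refine sum_congr rfl fun j hj => ?_
  rw [mem_range] at hj
  simp only [zetaConvTerm]
  rw [show m + (m - j) = 2 * m - j by omega, show 1 + m + (m - j) = 1 + 2 * m - j by omega]
  ring

end ZetaConvolution

section DominatedCoefficients

open Finset Topology

/-- A sequence of entire functions which is dominated, uniformly on bounded sets, by a summable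
sequence. -/
def LocallyDominated (c : ℕ → ℂ → ℂ) : Prop :=
  (∀ k, Differentiable ℂ (c k)) ∧
    ∀ R : ℝ, ∃ u : ℕ → ℝ, Summable u ∧ ∀ k s, ‖s‖ ≤ R → ‖c k s‖ ≤ u k

/-- Cauchy product of two sequences of functions. -/
def cauchyProduct (c d : ℕ → ℂ → ℂ) (k : ℕ) (s : ℂ) : ℂ :=
  ∑ p ∈ antidiagonal k, c p.1 s * d p.2 s

lemma LocallyDominated.summable_norm {c : ℕ → ℂ → ℂ} (hc : LocallyDominated c) (s : ℂ) :
    Summable fun k => ‖c k s‖ := by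
  obtain ⟨u, hu, h⟩ := hc.2 ‖s‖
  exact hu.of_nonneg_of_le (fun _ => norm_nonneg _) fun k => h k s le_rfl

lemma LocallyDominated.cauchyProduct {c d : ℕ → ℂ → ℂ} (hc : LocallyDominated c)
    (hd : LocallyDominated d) : LocallyDominated (cauchyProduct c d) := by
  refine ⟨fun k => ?_, fun R => ?_⟩
  · unfold _root_.cauchyProduct
    exact Differentiable.fun_sum fun p _ => (hc.1 _).mul (hd.1 _)
  · obtain ⟨u, hu, h⟩ := hc.2 R
    obtain ⟨v, hv, h'⟩ := hd.2 R
    have hsum : Summable fun p : ℕ × ℕ => |u p.1| * |v p.2| :=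
      hu.abs.mul_of_nonneg hv.abs (fun _ => abs_nonneg _) fun _ => abs_nonneg _
    refine ⟨fun k => ∑ p ∈ antidiagonal k, |u p.1| * |v p.2|,
      summable_sum_mul_antidiagonal_of_summable_mul (f := fun k => |u k|) (g := fun k => |v k|) hsum, fun k s hs => ?_⟩
    refine (norm_sum_le _ _).trans (sum_le_sum fun p _ => ?_)
    rw [norm_mul]
    exact mul_le_mul ((h _ _ hs).trans (le_abs_self _)) ((h' _ _ hs).trans (le_abs_self _))
      (norm_nonneg _) (abs_nonneg _)

lemma tsum_cauchyProduct_mul_pow {c d : ℕ → ℂ → ℂ} (hc : LocallyDominated c)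
    (hd : LocallyDominated d) (s : ℂ) {y : ℂ} (hy : ‖y‖ ≤ 1) :
    ∑' k, cauchyProduct c d k s * y ^ k = (∑' k, c k s * y ^ k) * ∑' k, d k s * y ^ k := by
  have key : ∀ {c : ℕ → ℂ → ℂ}, LocallyDominated c → Summable fun k => ‖c k s * y ^ k‖ :=
    fun hc => (hc.summable_norm s).of_nonneg_of_le (fun _ => norm_nonneg _) fun k => by
      rw [norm_mul, norm_pow]
      exact mul_le_of_le_one_right (norm_nonneg _) (pow_le_one₀ (norm_nonneg _) hy)
  rw [tsum_mul_tsum_eq_tsum_sum_antidiagonal_of_summable_norm (key hc) (key hd)]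
  refine tsum_congr fun k => ?_
  rw [cauchyProduct, sum_mul]
  refine sum_congr rfl fun p hp => ?_
  rw [← HasAntidiagonal.mem_antidiagonal.1 hp, pow_add]
  ring

/-- The Mellin-type series attached to the coefficients `c` and the exponent `l`. -/
noncomputable def mellinSeries (c : ℕ → ℂ → ℂ) (l : ℂ → ℂ) (s : ℂ) : ℂ :=
  ∑' k, c k s / (l s + 2 * k)

lemma mellinSeries_eq_sum_add {c : ℕ → ℂ → ℂ} (hc : LocallyDominated c) {l : ℂ → ℂ}
    (hl : Differentiable ℂ l) (z : ℂ) :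
    ∃ N₀ : ℕ, ∀ N ≥ N₀, ∃ A : ℂ → ℂ, AnalyticAt ℂ A z ∧
      ∀ᶠ s in 𝓝 z, mellinSeries c l s = ∑ k ∈ range N, c k s / (l s + 2 * k) + A s := by
  obtain ⟨δ, hδ, hδl⟩ := Metric.eventually_nhds_iff.1
    ((hl z).continuousAt.norm.eventually (gt_mem_nhds (lt_add_one ‖l z‖)))
  obtain ⟨u, hu, hcu⟩ := hc.2 (‖z‖ + δ)
  refine ⟨⌈‖l z‖ + 2⌉₊, fun N hN => ⟨fun s => ∑' k, c (k + N) s / (l s + 2 * (k + N : ℕ)), ?_, ?_⟩⟩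
  all_goals
    have hbig : ∀ s ∈ Metric.ball z δ, ∀ k : ℕ, 1 ≤ ‖l s + 2 * (k + N : ℕ)‖ := by
      intro s hs k
      have h1 := hδl (Metric.mem_ball.1 hs)
      have h2 : ‖(2 * (k + N : ℕ) : ℂ)‖ ≤ ‖l s + 2 * (k + N : ℕ)‖ + ‖l s‖ := by
        have := norm_sub_le (l s + 2 * (k + N : ℕ)) (l s)
        rwa [add_sub_cancel_left] at this
      have h3 : ‖l z‖ + 2 ≤ N := (Nat.le_ceil _).trans (by exact_mod_cast hN)
      rw [norm_mul, Complex.norm_natCast] at h2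
      push_cast at h2
      simp only [Complex.norm_ofNat] at h2
      have h4 : (0 : ℝ) ≤ k := k.cast_nonneg
      have h5 := norm_nonneg (l z)
      push_cast
      linarith
    have hbound : ∀ k : ℕ, ∀ s ∈ Metric.ball z δ,
        ‖c (k + N) s / (l s + 2 * (k + N : ℕ))‖ ≤ u (k + N) := by
      intro k s hs
      rw [norm_div]
      refine (div_le_self (norm_nonneg _) (hbig s hs k)).trans (hcu _ _ ?_)
      have := norm_sub_norm_le s z
      rw [Metric.mem_ball, dist_eq_norm] at hs
      linarith
    have hu' : Summable fun k => u (k + N) := (summable_nat_add_iff N).2 hu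
  · refine (differentiableOn_tsum_of_summable_norm hu' (fun k s hs => ?_) Metric.isOpen_ball
      hbound).analyticAt (Metric.ball_mem_nhds z hδ)
    refine ((hc.1 _ s).div ((hl s).add_const _) ?_).differentiableWithinAt
    intro h0
    have := hbig s hs k
    rw [h0, norm_zero] at this
    linarith
  · filter_upwards [Metric.ball_mem_nhds z hδ] with s hs
    rw [mellinSeries, ← Summable.sum_add_tsum_nat_add N]
    rw [← summable_nat_add_iff N]
    exact hu'.of_norm_bounded fun k => hbound k s hs

lemma meromorphicAt_mellinSeries {c : ℕ → ℂ → ℂ} (hc : LocallyDominated c) {l : ℂ → ℂ}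
    (hl : Differentiable ℂ l) (z : ℂ) : MeromorphicAt (mellinSeries c l) z := by
  obtain ⟨N, hN⟩ := mellinSeries_eq_sum_add hc hl z
  obtain ⟨A, hA, h⟩ := hN N le_rfl
  have h1 : MeromorphicAt (fun s => ∑ k ∈ range N, c k s / (l s + 2 * k) + A s) z := by
    refine MeromorphicAt.add (MeromorphicAt.fun_sum fun k _ => ?_) hA.meromorphicAt
    exact ((hc.1 k).analyticAt z).meromorphicAt.fun_div
      ((hl.analyticAt z).add analyticAt_const).meromorphicAt
  exact h1.congr (eventually_nhdsWithin_of_eventually_nhds (h.mono fun _ hs => hs.symm))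

lemma analyticAt_mellinSeries {c : ℕ → ℂ → ℂ} (hc : LocallyDominated c) {l : ℂ → ℂ}
    (hl : Differentiable ℂ l) {z : ℂ} (hz : ∀ k : ℕ, l z + 2 * k ≠ 0) :
    AnalyticAt ℂ (mellinSeries c l) z := by
  obtain ⟨N, hN⟩ := mellinSeries_eq_sum_add hc hl z
  obtain ⟨A, hA, h⟩ := hN N le_rfl
  refine AnalyticAt.congr ?_ (h.mono fun _ hs => hs.symm)
  refine AnalyticAt.add (Finset.analyticAt_fun_sum _ fun k _ => ?_) hA
  exact ((hc.1 k).analyticAt z).div ((hl.analyticAt z).add analyticAt_const) (hz k)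

lemma tendsto_sub_mul_mellinSeries {c : ℕ → ℂ → ℂ} (hc : LocallyDominated c) (n : ℕ) {z : ℂ}
    (hz : z = -(2 * n)) :
    Tendsto (fun s => (s - z) * mellinSeries c (fun s => s) s) (𝓝[≠] z) (𝓝 (c n z)) := by
  obtain ⟨N, hN⟩ := mellinSeries_eq_sum_add hc differentiable_id z
  obtain ⟨A, hA, h⟩ := hN (max N (n + 1)) (le_max_left _ _)
  have h1 : Tendsto (fun s => ∑ k ∈ range (max N (n + 1)), (s - z) * (c k s / (s + 2 * k)) +
      (s - z) * A s) (𝓝[≠] z)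
      (𝓝 (∑ k ∈ range (max N (n + 1)), (if k = n then c n z else 0) + (z - z) * A z)) := by
    refine Tendsto.add (tendsto_finsetSum _ fun k _ => ?_) ?_
    · split_ifs with hk
      · subst hk
        refine ((hc.1 k z).continuousAt.tendsto.mono_left nhdsWithin_le_nhds).congr' ?_
        filter_upwards [self_mem_nhdsWithin] with s hs
        have h0 : s - z ≠ 0 := sub_ne_zero.2 hs
        have h2 : s + 2 * k = s - z := by rw [hz]; ring
        rw [h2]
        field_simp
      · have h0 : z + 2 * k ≠ 0 := by
          rw [hz]
          intro h0
          apply hk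
          have h2 : (k : ℂ) = n := by linear_combination h0 / 2
          exact_mod_cast h2
        have h2 : ContinuousAt (fun s => (s - z) * (c k s / (s + 2 * k))) z :=
          (continuousAt_id.sub continuousAt_const).mul ((hc.1 k z).continuousAt.div
            (continuousAt_id.add continuousAt_const) h0)
        have h3 := h2.tendsto.mono_left (nhdsWithin_le_nhds (s := {z}ᶜ))
        simpa using h3
    · exact ((continuousAt_id.sub continuousAt_const).mul
        hA.continuousAt).tendsto.mono_left nhdsWithin_le_nhds
  rw [sum_ite_eq' (range _) n, if_pos (mem_range.2 (by simp)), sub_self, zero_mul, add_zero] at h1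
  refine h1.congr' ?_
  filter_upwards [eventually_nhdsWithin_of_eventually_nhds h] with s hs
  have hs' : mellinSeries c (fun s => s) s = _ := hs
  rw [hs', mul_add, mul_sum]
  rfl

end DominatedCoefficients

section EvenCoefficients

open Finset Topology

/-- The entire function `(w - 1) ζ(w)`. -/
noncomputable def zetaEntire : ℂ → ℂ := Function.update (fun w => (w - 1) * riemannZeta w) 1 1

lemma zetaEntire_of_ne {w : ℂ} (hw : w ≠ 1) : zetaEntire w = (w - 1) * riemannZeta w :=
  Function.update_of_ne hw _ _

lemma differentiable_zetaEntire : Differentiable ℂ zetaEntire := by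
  have h : DifferentiableOn ℂ zetaEntire (Set.univ \ {1}) := by
    intro w hw
    have hw' : w ≠ 1 := by simpa using hw
    refine DifferentiableAt.differentiableWithinAt ?_
    refine (((differentiableAt_id.sub_const 1).mul
      (differentiableAt_riemannZeta hw')).congr_of_eventuallyEq ?_)
    filter_upwards [isOpen_ne.mem_nhds hw'] with v hv
    exact zetaEntire_of_ne hv
  rw [← differentiableOn_univ]
  refine (Complex.differentiableOn_compl_singleton_and_continuousAt_iff Filter.univ_mem).1 ⟨h, ?_⟩
  exact continuousAt_update_same.2 riemannZeta_residue_one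

/-- The normalised Taylor coefficients of `-s * (ζ(1 - s, 1 + x) + ζ(1 - s, 1 - x))` in the
variable `(2 * x) ^ 2`. -/
noncomputable def evenCoeff (k : ℕ) (s : ℂ) : ℂ :=
  2 * (∏ j ∈ range (2 * k), ((j : ℂ) - s) / (j + 1)) * zetaEntire (1 - s + 2 * k) * (1 / 4) ^ k

lemma differentiable_evenCoeff (k : ℕ) : Differentiable ℂ (evenCoeff k) := by
  unfold evenCoeff
  refine (((Differentiable.fun_finsetProd fun j _ => ?_).const_mul 2).mul
    (differentiable_zetaEntire.comp (by fun_prop))).mul_const _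
  fun_prop

lemma prod_add_div_le (N n : ℕ) :
    ∏ j ∈ range n, ((j : ℝ) + N) / (j + 1) ≤ ((n : ℝ) + 1) ^ N := by
  induction n with
  | zero => simp
  | succ n ih =>
    rw [prod_range_succ]
    have h0 : (0 : ℝ) < n + 1 := by positivity
    have h := one_add_mul_le_pow (a := ((n : ℝ) + 1)⁻¹) (by
      have : (0 : ℝ) ≤ ((n : ℝ) + 1)⁻¹ := by positivity
      linarith) N
    have h1 : ((n : ℝ) + N) / (n + 1) ≤ (1 + ((n : ℝ) + 1)⁻¹) ^ N := by
      refine le_trans ?_ h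
      rw [div_le_iff₀ h0]
      field_simp
      linarith
    calc _ ≤ ((n : ℝ) + 1) ^ N * (1 + ((n : ℝ) + 1)⁻¹) ^ N :=
          mul_le_mul ih h1 (by positivity) (by positivity)
      _ = _ := by
          rw [← mul_pow]
          congr 1
          push_cast
          field_simp

lemma norm_riemannZeta_le {w : ℂ} (hw : 2 ≤ w.re) :
    ‖riemannZeta w‖ ≤ ∑' n : ℕ, 1 / (n : ℝ) ^ 2 := by
  rw [zeta_eq_tsum_one_div_nat_cpow (by linarith)]
  refine tsum_of_norm_bounded (Real.summable_one_div_nat_pow.2 one_lt_two).hasSum fun n => ?_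
  rcases Nat.eq_zero_or_pos n with rfl | hn
  · rw [Nat.cast_zero, zero_cpow (by rintro rfl; simp at hw; linarith)]
    simp
  · rw [norm_div, norm_one, norm_natCast_cpow_of_pos hn]
    have : (1 : ℝ) ≤ n := by exact_mod_cast hn
    refine one_div_le_one_div_of_le (by positivity) ?_
    rw [← Real.rpow_natCast]
    exact Real.rpow_le_rpow_of_exponent_le this (by simpa using hw)

lemma norm_evenCoeff_le (N k : ℕ) (s : ℂ) (hs : ‖s‖ ≤ N) (hk : N + 1 ≤ 2 * k) :
    ‖evenCoeff k s‖ ≤ (2 * ((N : ℝ) + 1) * 2 ^ (N + 1) * (∑' n : ℕ, 1 / (n : ℝ) ^ 2) * 4) *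
      (((k + 1 : ℕ) : ℝ) ^ (N + 1) * (1 / 4) ^ (k + 1)) := by
  have hre : 2 ≤ (1 - s + 2 * k).re := by
    have h1 : s.re ≤ N := (Complex.re_le_norm s).trans hs
    have h2 : ((N : ℝ) + 1) ≤ 2 * k := by exact_mod_cast hk
    simp
    linarith
  have hne : 1 - s + 2 * k ≠ 1 := by
    intro h; rw [h] at hre; norm_num at hre
  have h1 : ‖∏ j ∈ range (2 * k), ((j : ℂ) - s) / (j + 1)‖ ≤ (2 * (k : ℝ) + 1) ^ N := by
    rw [norm_prod]
    refine le_trans (prod_le_prod (fun _ _ => norm_nonneg _) fun j _ => ?_)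
      ((prod_add_div_le N (2 * k)).trans (by push_cast; rfl))
    rw [norm_div, show (j : ℂ) + 1 = ((j + 1 : ℕ) : ℂ) by push_cast; rfl, Complex.norm_natCast]
    push_cast
    gcongr
    exact (norm_sub_le _ _).trans (by rw [Complex.norm_natCast]; linarith)
  have h2 : ‖zetaEntire (1 - s + 2 * k)‖ ≤
      (((N : ℝ) + 1) * (2 * k + 1)) * ∑' n : ℕ, 1 / (n : ℝ) ^ 2 := by
    rw [zetaEntire_of_ne hne, norm_mul]
    refine mul_le_mul ?_ (norm_riemannZeta_le hre) (norm_nonneg _) (by positivity)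
    rw [show 1 - s + 2 * k - 1 = ((2 * k : ℕ) : ℂ) - s by push_cast; ring]
    refine (norm_sub_le _ _).trans ?_
    rw [Complex.norm_natCast]
    push_cast
    nlinarith [(N.cast_nonneg : (0 : ℝ) ≤ N), (k.cast_nonneg : (0 : ℝ) ≤ k),
      mul_nonneg (N.cast_nonneg : (0 : ℝ) ≤ N) (k.cast_nonneg : (0 : ℝ) ≤ k)]
  have hS : 0 ≤ ∑' n : ℕ, 1 / (n : ℝ) ^ 2 := tsum_nonneg fun n => by positivity
  have h3 : (2 * (k : ℝ) + 1) ≤ 2 * (k + 1) := by linarith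
  rw [evenCoeff, norm_mul, norm_mul, norm_mul, norm_pow]
  have h4 : ‖(1 / 4 : ℂ)‖ = 1 / 4 := by simp
  rw [h4, Complex.norm_ofNat]
  calc _ ≤ 2 * (2 * (k + 1)) ^ N * ((((N : ℝ) + 1) * (2 * (k + 1))) *
        ∑' n : ℕ, 1 / (n : ℝ) ^ 2) * (1 / 4) ^ k := by
        gcongr
        · exact h1.trans (by gcongr)
        · exact h2.trans (by gcongr)
    _ = _ := by
        push_cast
        rw [mul_pow]
        ring

lemma locallyDominated_evenCoeff : LocallyDominated evenCoeff := by
  refine ⟨differentiable_evenCoeff, fun R => ?_⟩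
  have hB : ∀ k, ∃ B : ℝ, ∀ s : ℂ, ‖s‖ ≤ R → ‖evenCoeff k s‖ ≤ B := by
    intro k
    obtain ⟨B, hB⟩ := (isCompact_closedBall (0 : ℂ) R).exists_bound_of_continuousOn
      (differentiable_evenCoeff k).continuous.continuousOn
    exact ⟨B, fun s hs => hB s (by simpa using hs)⟩
  choose B hB using hB
  set N := ⌈R⌉₊ with hN
  set v : ℕ → ℝ := fun k =>
    (2 * ((N : ℝ) + 1) * 2 ^ (N + 1) * (∑' n : ℕ, 1 / (n : ℝ) ^ 2) * 4) *
      (((k + 1 : ℕ) : ℝ) ^ (N + 1) * (1 / 4) ^ (k + 1)) with hv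
  have hvs : Summable v := by
    refine Summable.mul_left _ ?_
    exact (summable_nat_add_iff 1).2 (summable_pow_mul_geometric_of_norm_lt_one (N + 1)
      (r := (1 / 4 : ℝ)) (by norm_num))
  refine ⟨fun k => if k < N + 1 then B k else v k, ?_, fun k s hs => ?_⟩
  · rw [← summable_nat_add_iff (N + 1)]
    refine ((summable_nat_add_iff (N + 1)).2 hvs).congr fun k => ?_
    rw [if_neg (by omega)]
  · dsimp only
    split_ifs with hk
    · exact hB k s hs
    · exact norm_evenCoeff_le N k s (hs.trans (Nat.le_ceil R)) (by omega)

end EvenCoefficients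

section HurwitzExpansion

open Finset Topology

lemma ringChoose_neg_eq_prod (w : ℂ) (k : ℕ) :
    Ring.choose (-w) k = (-1) ^ k * ∏ j ∈ range k, ((j : ℂ) + w) / (j + 1) := by
  induction k with
  | zero => simp
  | succ k ih =>
    have h := Ring.descPochhammer_eq_factorial_smul_choose (-w) k
    have h' := Ring.descPochhammer_eq_factorial_smul_choose (-w) (k + 1)
    rw [descPochhammer_succ_right, Polynomial.smeval_mul, h] at h'
    simp only [Polynomial.smeval_sub, Polynomial.smeval_X, Polynomial.smeval_natCast, pow_one,
      pow_zero, nsmul_eq_mul, mul_one, Nat.factorial_succ] at h'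
    push_cast at h'
    have hk : ((k.factorial : ℕ) : ℂ) ≠ 0 := by exact_mod_cast k.factorial_ne_zero
    have hk1 : (k : ℂ) + 1 ≠ 0 := by exact_mod_cast k.succ_ne_zero
    have h2 : Ring.choose (-w) (k + 1) = Ring.choose (-w) k * (-w - k) / (k + 1) := by
      rw [eq_div_iff hk1]
      apply mul_left_cancel₀ hk
      linear_combination -h'
    rw [h2, ih, prod_range_succ]
    ring

lemma hasSum_one_add_cpow_add_one_sub_cpow (w : ℂ) {y : ℂ} (hy : ‖y‖ < 1) :
    HasSum (fun k : ℕ => 2 * (∏ j ∈ range (2 * k), ((j : ℂ) + w) / (j + 1)) * y ^ (2 * k))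
      ((1 + y) ^ (-w) + (1 - y) ^ (-w)) := by
  have h : ∀ z : ℂ, ‖z‖ < 1 → HasSum (fun k : ℕ => Ring.choose (-w) k * z ^ k)
      ((1 + z) ^ (-w)) := by
    intro z hz
    have h1 := (one_add_cpow_hasFPowerSeriesOnBall_zero (a := -w)).hasSum (y := z) (by
      rw [← ENNReal.ofReal_one, Metric.eball_ofReal]
      simpa using hz)
    simpa only [binomialSeries_apply, List.ofFn_const, List.prod_replicate, smul_eq_mul,
      zero_add] using h1
  have h2 := (h y hy).add (h (-y) (by simpa using hy))
  rw [← sub_eq_add_neg] at h2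
  have hinj : Function.Injective fun k : ℕ => 2 * k := fun a b hab => by
    simpa using hab
  rw [← hinj.hasSum_iff] at h2
  · refine h2.congr_fun fun k => ?_
    simp only [Function.comp_apply, ringChoose_neg_eq_prod]
    rw [pow_mul (-1 : ℂ), pow_mul (-y)]
    simp
    ring
  · intro k hk
    have hodd : Odd k := by
      rw [← Nat.not_even_iff_odd]
      rintro ⟨r, rfl⟩
      exact hk ⟨r, by simp; ring⟩
    rw [hodd.neg_pow]
    ring

lemma two_mul_hurwitzZetaEven_of_one_lt_re {x : ℝ} (hx0 : 0 < x) (hx : x ≤ 1 / 2) {w : ℂ}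
    (hw : 1 < w.re) :
    2 * HurwitzZeta.hurwitzZetaEven x w = (x : ℂ) ^ (-w) + ∑' k : ℕ,
      2 * (∏ j ∈ range (2 * k), ((j : ℂ) + w) / (j + 1)) * riemannZeta (w + 2 * k) *
        (x : ℂ) ^ (2 * k) := by
  set b : ℕ → ℂ := fun k => 2 * ∏ j ∈ range (2 * k), ((j : ℂ) + w) / (j + 1) with hb
  set f : ℕ → ℕ → ℂ := fun n k => b k * (x : ℂ) ^ (2 * k) * (1 / ((n : ℂ) + 1) ^ (w + 2 * k))
    with hf
  have hxn : ‖(x : ℂ)‖ = x := by rw [Complex.norm_real, Real.norm_of_nonneg hx0.le]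
  have hN : ∀ n : ℕ, (n : ℂ) + 1 = ((n + 1 : ℕ) : ℂ) := fun n => by push_cast; rfl
  have hN0 : ∀ n : ℕ, ((n : ℂ) + 1) ≠ 0 := fun n => by
    rw [hN]; exact_mod_cast n.succ_ne_zero
  have hpow : ∀ (n k : ℕ), ((n : ℂ) + 1) ^ (w + 2 * k) = (n + 1) ^ w * (n + 1) ^ (2 * k) := by
    intro n k
    rw [cpow_add _ _ (hN0 n), ← cpow_natCast]
    push_cast
    rfl
  have hrow : ∀ n : ℕ, HasSum (f n) (1 / (↑|((n + 1 : ℕ) : ℤ) + x| : ℂ) ^ w +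
      1 / (↑|((-(n + 1 : ℕ) : ℤ) : ℝ) + x| : ℂ) ^ w) := by
    intro n
    have hn : (0 : ℝ) < n + 1 := by positivity
    have hn1 : (1 : ℝ) ≤ n + 1 := by linarith [(n.cast_nonneg : (0 : ℝ) ≤ n)]
    have hy : ‖(x : ℂ) / (n + 1)‖ < 1 := by
      rw [norm_div, hxn, hN, Complex.norm_natCast]
      push_cast
      rw [div_lt_one hn]
      linarith
    have h1 := (hasSum_one_add_cpow_add_one_sub_cpow w hy).mul_left (1 / ((n : ℂ) + 1) ^ w)
    convert! h1 using 1
    · funext k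
      simp only [hf, hb, hpow]
      rw [div_pow]
      ring
    · have e1 : |(((n + 1 : ℕ) : ℤ) : ℝ) + x| = (n + 1) * (1 + x / (n + 1)) := by
        rw [abs_of_pos (by push_cast; linarith)]
        push_cast
        field_simp
      have e2 : |((-(n + 1 : ℕ) : ℤ) : ℝ) + x| = (n + 1) * (1 - x / (n + 1)) := by
        rw [abs_of_neg (by push_cast; linarith)]
        push_cast
        field_simp
        ring
      have hlt : x / (n + 1) < 1 := by rw [div_lt_one hn]; linarith
      have hpos : 0 < x / (n + 1) := by positivity
      rw [e1, e2, Complex.ofReal_mul, Complex.ofReal_mul,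
        mul_cpow_ofReal_nonneg hn.le (by linarith), mul_cpow_ofReal_nonneg hn.le (by linarith)]
      push_cast
      rw [cpow_neg, cpow_neg]
      ring
  have hbs : Summable fun k => ‖b k‖ * (1 / 4) ^ k := by
    have h1 := (hasSum_one_add_cpow_add_one_sub_cpow w (y := 1 / 2) (by norm_num)).summable.norm
    refine h1.congr fun k => ?_
    rw [norm_mul, norm_pow, pow_mul]
    norm_num [hb]
  have hns : Summable fun n : ℕ => 1 / ((n + 1 : ℕ) : ℝ) ^ w.re :=
    (summable_nat_add_iff 1).2 (Real.summable_one_div_nat_rpow.2 hw)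
  have hsum : Summable (Function.uncurry f) := by
    have h1 : Summable fun p : ℕ × ℕ => (1 / ((p.1 + 1 : ℕ) : ℝ) ^ w.re) *
        (‖b p.2‖ * (1 / 4) ^ p.2) :=
      hns.mul_of_nonneg hbs (fun _ => by positivity) fun _ => by positivity
    refine h1.of_norm_bounded fun p => ?_
    obtain ⟨n, k⟩ := p
    simp only [Function.uncurry, hf, hpow]
    rw [norm_mul, norm_mul (b k), norm_pow, norm_div, norm_mul (_ ^ w), norm_pow, hN,
      norm_natCast_cpow_of_pos n.succ_pos, hxn, Complex.norm_natCast, norm_one, mul_comm]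
    have hn1 : (1 : ℝ) ≤ ((n + 1 : ℕ) : ℝ) := by exact_mod_cast n.succ_pos
    have h2 : (1 : ℝ) ≤ ((n + 1 : ℕ) : ℝ) ^ (2 * k) := one_le_pow₀ hn1
    have h3 : (0 : ℝ) < ((n + 1 : ℕ) : ℝ) ^ w.re := by positivity
    gcongr
    · nlinarith
    · rw [pow_mul]
      gcongr
      nlinarith
  have hint := (HurwitzZeta.hasSum_int_hurwitzZetaEven x hw).nat_add_neg
  rw [← hasSum_nat_add_iff' 1] at hint
  have h2 := hint.mul_left 2
  have h3 : ∑' n : ℕ, ∑' k : ℕ, f n k = 2 * HurwitzZeta.hurwitzZetaEven x w - (x : ℂ) ^ (-w) := by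
    calc ∑' n : ℕ, ∑' k : ℕ, f n k = _ := tsum_congr fun n => (hrow n).tsum_eq
      _ = _ := by
        convert! h2.tsum_eq using 1
        · refine tsum_congr fun n => ?_
          push_cast
          ring
        · simp only [range_one, sum_singleton]
          rw [cpow_neg]
          simp [abs_of_pos hx0]
          ring
  have h4 : ∀ k : ℕ, ∑' n : ℕ, f n k = b k * riemannZeta (w + 2 * k) * (x : ℂ) ^ (2 * k) := by
    intro k
    have hre : 1 < (w + 2 * k).re := by
      simp
      linarith [(k.cast_nonneg : (0 : ℝ) ≤ k)]
    simp only [hf]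
    rw [tsum_mul_left, zeta_eq_tsum_one_div_nat_add_one_cpow hre]
    ring
  rw [← hsum.tsum_comm] at h3
  simp only [h4] at h3
  rw [h3]
  ring

lemma tsum_evenCoeff_eq_of_re_neg {x : ℝ} (hx0 : 0 < x) (hx : x ≤ 1 / 2) {s : ℂ}
    (hs : s.re < 0) :
    ∑' k, evenCoeff k s * ((4 * x ^ 2 : ℝ) : ℂ) ^ k =
      -s * (2 * HurwitzZeta.hurwitzZetaEven x (1 - s) - (x : ℂ) ^ (s - 1)) := by
  rw [two_mul_hurwitzZetaEven_of_one_lt_re hx0 hx (w := 1 - s) (by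
      rw [sub_re, one_re]; linarith), neg_sub,
    add_sub_cancel_left, ← tsum_mul_left]
  refine tsum_congr fun k => ?_
  have hne : 1 - s + 2 * k ≠ 1 := by
    intro h
    have h1 := congrArg Complex.re h
    simp at h1
    linarith [(k.cast_nonneg : (0 : ℝ) ≤ k)]
  have hprod : (∏ j ∈ range (2 * k), ((j : ℂ) - s) / (j + 1)) * (2 * k - s) =
      -s * ∏ j ∈ range (2 * k), ((j : ℂ) + (1 - s)) / (j + 1) := by
    rw [prod_div_distrib, prod_div_distrib, div_mul_eq_mul_div, mul_div_assoc']
    congr 1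
    have h1 := prod_range_succ (fun j : ℕ => (j : ℂ) - s) (2 * k)
    rw [prod_range_succ'] at h1
    push_cast at h1
    rw [← h1, zero_sub, mul_comm]
    congr 1
    exact prod_congr rfl fun j _ => by ring
  rw [evenCoeff, zetaEntire_of_ne hne]
  push_cast
  rw [mul_pow, ← pow_mul, one_div, inv_pow]
  have h4 : (4 : ℂ) ^ k ≠ 0 := pow_ne_zero _ (by norm_num)
  field_simp
  linear_combination riemannZeta (1 - s + 2 * k) * (x : ℂ) ^ (2 * k) * hprod

lemma tsum_evenCoeff_eq {x : ℝ} (hx0 : 0 < x) (hx : x ≤ 1 / 2) {s : ℂ} (hs : s ≠ 0) :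
    ∑' k, evenCoeff k s * ((4 * x ^ 2 : ℝ) : ℂ) ^ k =
      -s * (2 * HurwitzZeta.hurwitzZetaEven x (1 - s) - (x : ℂ) ^ (s - 1)) := by
  have hx1 : 4 * x ^ 2 ≤ 1 := by nlinarith
  have hxn : ‖((4 * x ^ 2 : ℝ) : ℂ)‖ ≤ 1 := by
    rw [Complex.norm_real, Real.norm_of_nonneg (by positivity)]
    exact hx1
  have hL : Differentiable ℂ fun s => ∑' k, evenCoeff k s * ((4 * x ^ 2 : ℝ) : ℂ) ^ k := by
    intro z
    obtain ⟨u, hu, h⟩ := locallyDominated_evenCoeff.2 (‖z‖ + 1)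
    refine (differentiableOn_tsum_of_summable_norm (U := Metric.ball z 1) hu (fun k => ?_)
      Metric.isOpen_ball (fun k s hs => ?_)).differentiableAt
        (Metric.ball_mem_nhds z one_pos)
    · exact ((differentiable_evenCoeff k).mul_const _).differentiableOn
    · rw [norm_mul, norm_pow]
      refine (mul_le_of_le_one_right (norm_nonneg _) (pow_le_one₀ (norm_nonneg _) hxn)).trans
        (h k s ?_)
      have h1 := norm_sub_norm_le s z
      rw [Metric.mem_ball, dist_eq_norm] at hs
      linarith
  have hR : DifferentiableOn ℂ (fun s : ℂ => -s * (2 * HurwitzZeta.hurwitzZetaEven x (1 - s) -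
      (x : ℂ) ^ (s - 1))) {0}ᶜ := by
    intro z hz
    have h1 : DifferentiableAt ℂ (fun s : ℂ => HurwitzZeta.hurwitzZetaEven x (1 - s)) z :=
      DifferentiableAt.comp z (HurwitzZeta.differentiableAt_hurwitzZetaEven x (by
        intro h
        exact hz (by simpa using h))) (by fun_prop)
    have h2 : DifferentiableAt ℂ (fun s : ℂ => (x : ℂ) ^ (s - 1)) z :=
      DifferentiableAt.const_cpow (by fun_prop) (Or.inl (by exact_mod_cast hx0.ne'))
    exact (differentiableAt_id.neg.mul ((h1.const_mul 2).sub h2)).differentiableWithinAt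
  have hopen : IsOpen ({0}ᶜ : Set ℂ) := isOpen_compl_singleton
  have hconn : IsPreconnected ({0}ᶜ : Set ℂ) :=
    (isConnected_compl_singleton_of_one_lt_rank (by simp) 0).isPreconnected
  have h := (hL.differentiableOn.analyticOnNhd hopen).eqOn_of_preconnected_of_eventuallyEq
    (hR.analyticOnNhd hopen) hconn (z₀ := -1) (by simp) (by
      filter_upwards [(isOpen_lt Complex.continuous_re continuous_const).mem_nhds
        (show (-1 : ℂ).re < 0 by simp)] with s hs
      exact tsum_evenCoeff_eq_of_re_neg hx0 hx hs)
  exact h (by simpa using hs)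

end HurwitzExpansion

section CosineIntegral

open Topology MeasureTheory

/-- The double series `∑ (m₁ m₂ (m₁ + m₂))⁻ˢ` over pairs of positive integers. -/
noncomputable def wittenSeries (s : ℂ) : ℂ :=
  ∑' p : ℕ+ × ℕ+, 1 / (((p.1 : ℕ) : ℂ) * ((p.2 : ℕ) : ℂ) *
    (((p.1 : ℕ) : ℂ) + ((p.2 : ℕ) : ℂ))) ^ s

lemma integral_cos_two_pi_int_mul (k : ℤ) :
    ∫ x in (0 : ℝ)..1 / 2, Real.cos (2 * Real.pi * k * x) = if k = 0 then 1 / 2 else 0 := by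
  split_ifs with hk
  · simp [hk]
  · have h0 : (2 * Real.pi * k : ℝ) ≠ 0 := by
      have : (k : ℝ) ≠ 0 := by exact_mod_cast hk
      have := Real.pi_pos
      positivity
    rw [intervalIntegral.integral_comp_mul_left (fun y => Real.cos y) h0, integral_cos,
      show 2 * Real.pi * k * (1 / 2) = k * Real.pi by ring, Real.sin_int_mul_pi]
    simp

lemma integral_cos_mul_cos_mul_cos (a b c : ℕ+) :
    ∫ x in (0 : ℝ)..1 / 2, 2 * Real.cos (2 * Real.pi * a * x) * (2 * Real.cos (2 * Real.pi * b * x)) *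
      (2 * Real.cos (2 * Real.pi * c * x)) =
    (if c = a + b then 1 else 0) + (if b = a + c then 1 else 0) + (if a = b + c then 1 else 0) := by
  have h : ∀ x : ℝ, 2 * Real.cos (2 * Real.pi * a * x) * (2 * Real.cos (2 * Real.pi * b * x)) *
      (2 * Real.cos (2 * Real.pi * c * x)) =
      2 * Real.cos (2 * Real.pi * ((a + b + c : ℤ) : ℝ) * x) +
      2 * Real.cos (2 * Real.pi * ((a + b - c : ℤ) : ℝ) * x) +
      2 * Real.cos (2 * Real.pi * ((a + c - b : ℤ) : ℝ) * x) +
      2 * Real.cos (2 * Real.pi * ((b + c - a : ℤ) : ℝ) * x) := by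
    intro x
    push_cast
    simp only [add_mul, sub_mul, mul_add, mul_sub, Real.cos_add, Real.cos_sub, Real.sin_add]
    ring
  have hi : ∀ k : ℤ, IntervalIntegrable (fun x : ℝ => 2 * Real.cos (2 * Real.pi * (k : ℝ) * x))
      volume 0 (1 / 2) := fun k => (by fun_prop : Continuous _).intervalIntegrable _ _
  simp_rw [h]
  rw [intervalIntegral.integral_add (((hi _).add (hi _)).add (hi _)) (hi _),
    intervalIntegral.integral_add ((hi _).add (hi _)) (hi _),
    intervalIntegral.integral_add (hi _) (hi _)]
  simp only [intervalIntegral.integral_const_mul, integral_cos_two_pi_int_mul]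
  have ha := a.pos
  have hb := b.pos
  have hc := c.pos
  have e1 : ¬((a : ℤ) + b + c = 0) := by omega
  have e2 : ((a : ℤ) + b - c = 0) ↔ c = a + b := by
    rw [← PNat.coe_inj, PNat.add_coe]; omega
  have e3 : ((a : ℤ) + c - b = 0) ↔ b = a + c := by
    rw [← PNat.coe_inj, PNat.add_coe]; omega
  have e4 : ((b : ℤ) + c - a = 0) ↔ a = b + c := by
    rw [← PNat.coe_inj, PNat.add_coe]; omega
  rw [if_neg e1]
  simp only [e2, e3, e4]
  split_ifs <;> norm_num

lemma norm_pnat_cpow (n : ℕ+) (s : ℂ) : ‖((n : ℕ) : ℂ) ^ s‖ = ((n : ℕ) : ℝ) ^ s.re :=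
  norm_natCast_cpow_of_pos n.pos s

lemma summable_pnat_rpow {r : ℝ} (hr : 1 < r) : Summable fun n : ℕ+ => 1 / ((n : ℕ) : ℝ) ^ r :=
  (Real.summable_one_div_nat_rpow.2 hr).comp_injective PNat.coe_injective

lemma hasSum_pnat_cosZeta (x : ℝ) {s : ℂ} (hs : 1 < s.re) :
    HasSum (fun n : ℕ+ => (1 / ((n : ℕ) : ℂ) ^ s) * ((2 * Real.cos (2 * Real.pi * n * x) : ℝ) : ℂ))
      (2 * HurwitzZeta.cosZeta x s) := by
  have h := (HurwitzZeta.hasSum_nat_cosZeta x hs).mul_left 2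
  rw [← PNat.coe_injective.hasSum_iff] at h
  · refine h.congr_fun fun n => ?_
    simp only [Function.comp_apply]
    push_cast
    rw [show 2 * (Real.pi : ℂ) * x * n = 2 * Real.pi * n * x by ring]
    ring
  · intro n hn
    have hn0 : n = 0 := by
      by_contra h0
      exact hn ⟨⟨n, Nat.pos_of_ne_zero h0⟩, rfl⟩
    have hs0 : s ≠ 0 := by
      rintro rfl
      norm_num at hs
    simp [hn0, zero_cpow hs0]

lemma summable_pnat_triple {r : ℝ} (hr : 1 < r) : Summable fun p : (ℕ+ × ℕ+) × ℕ+ =>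
    1 / ((p.1.1 : ℕ) : ℝ) ^ r * (1 / ((p.1.2 : ℕ) : ℝ) ^ r) * (1 / ((p.2 : ℕ) : ℝ) ^ r) :=
  ((summable_pnat_rpow hr).mul_of_nonneg (summable_pnat_rpow hr) (fun _ => by positivity)
    fun _ => by positivity).mul_of_nonneg (summable_pnat_rpow hr) (fun _ => by positivity)
    fun _ => by positivity

/-- Summand of the triple Dirichlet series obtained by cubing the zeta series. -/
noncomputable def tripleTerm (s : ℂ) (p : (ℕ+ × ℕ+) × ℕ+) : ℂ :=
  1 / ((p.1.1 : ℕ) : ℂ) ^ s * (1 / ((p.1.2 : ℕ) : ℂ) ^ s) * (1 / ((p.2 : ℕ) : ℂ) ^ s)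

lemma norm_tripleTerm (s : ℂ) (p : (ℕ+ × ℕ+) × ℕ+) : ‖tripleTerm s p‖ =
    1 / ((p.1.1 : ℕ) : ℝ) ^ s.re * (1 / ((p.1.2 : ℕ) : ℝ) ^ s.re) *
      (1 / ((p.2 : ℕ) : ℝ) ^ s.re) := by
  simp [tripleTerm, norm_pnat_cpow]

lemma tripleTerm_add_eq (s : ℂ) (a b : ℕ+) : tripleTerm s ((a, b), a + b) =
    1 / (((a : ℕ) : ℂ) * ((b : ℕ) : ℂ) * (((a : ℕ) : ℂ) + ((b : ℕ) : ℂ))) ^ s := by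
  have h : ((a : ℕ) : ℂ) + ((b : ℕ) : ℂ) = ((a + b : ℕ) : ℂ) := by push_cast; rfl
  rw [h, ← Nat.cast_mul, natCast_mul_natCast_cpow, Nat.cast_mul, natCast_mul_natCast_cpow]
  simp only [tripleTerm, PNat.add_coe]
  field_simp

lemma hasSum_tripleTerm_ite (s : ℂ) (hs : 1 < s.re) (g : ℕ+ × ℕ+ → (ℕ+ × ℕ+) × ℕ+)
    (hg : Function.Injective g) (P : (ℕ+ × ℕ+) × ℕ+ → Prop) [DecidablePred P]
    (hP : ∀ q, P q ↔ q ∈ Set.range g)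
    (hterm : ∀ p, tripleTerm s (g p) = tripleTerm s (p, p.1 + p.2)) :
    HasSum (fun q => tripleTerm s q * if P q then 1 else 0) (wittenSeries s) := by
  rw [← hg.hasSum_iff]
  · have h : (fun q => tripleTerm s q * if P q then 1 else 0) ∘ g =
        fun p : ℕ+ × ℕ+ => 1 / (((p.1 : ℕ) : ℂ) * ((p.2 : ℕ) : ℂ) *
          (((p.1 : ℕ) : ℂ) + ((p.2 : ℕ) : ℂ))) ^ s := by
      funext p
      rw [Function.comp_apply, if_pos ((hP _).2 ⟨p, rfl⟩), mul_one, hterm, tripleTerm_add_eq]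
    rw [h]
    refine Summable.hasSum ?_
    rw [← h]
    refine Summable.comp_injective ?_ hg
    refine (summable_pnat_triple hs).of_norm_bounded fun q => ?_
    rw [norm_mul, norm_tripleTerm]
    refine mul_le_of_le_one_right (by positivity) ?_
    split_ifs <;> simp
  · intro q hq
    rw [if_neg (fun h => hq ((hP q).1 h)), mul_zero]

lemma hasSum_pow_three {ι : Type*} {t : ι → ℂ} {a : ℂ} (h : HasSum t a) :
    HasSum (fun q : (ι × ι) × ι => t q.1.1 * t q.1.2 * t q.2) (a ^ 3) := by
  have hn : Summable fun n => ‖t n‖ := h.summable.norm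
  have hs2 : Summable fun q : ι × ι => ‖t q.1 * t q.2‖ :=
    (hn.mul_of_nonneg hn (fun _ => norm_nonneg _) fun _ => norm_nonneg _).congr fun q =>
      (norm_mul _ _).symm
  have h2 : HasSum (fun q : ι × ι => t q.1 * t q.2) (a * a) :=
    h.mul h (f := t) (g := t) hs2.of_norm
  have hs3 : Summable fun q : (ι × ι) × ι => ‖t q.1.1 * t q.1.2 * t q.2‖ :=
    (hs2.mul_of_nonneg hn (fun _ => norm_nonneg _) fun _ => norm_nonneg _).congr fun q =>
      (norm_mul _ _).symm
  have h3 := h2.mul h hs3.of_norm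
  rwa [show a * a * a = a ^ 3 by ring] at h3

lemma integral_cosZeta_pow_three {s : ℂ} (hs : 1 < s.re) :
    ∫ x in (0 : ℝ)..1 / 2, (2 * HurwitzZeta.cosZeta x s) ^ 3 = 3 * wittenSeries s := by
  set C : (ℕ+ × ℕ+) × ℕ+ → ℝ → ℝ := fun q x => 2 * Real.cos (2 * Real.pi * q.1.1 * x) *
    (2 * Real.cos (2 * Real.pi * q.1.2 * x)) * (2 * Real.cos (2 * Real.pi * q.2 * x)) with hC
  have hC8 : ∀ q x, |C q x| ≤ 8 := by
    intro q x
    simp only [hC, abs_mul, abs_two]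
    have h1 := Real.abs_cos_le_one (2 * Real.pi * q.1.1 * x)
    have h2 := Real.abs_cos_le_one (2 * Real.pi * q.1.2 * x)
    have h3 := Real.abs_cos_le_one (2 * Real.pi * q.2 * x)
    calc _ ≤ 2 * (1 : ℝ) * (2 * 1) * (2 * 1) := by gcongr
      _ = 8 := by norm_num
  have hbound : ∀ q x, ‖tripleTerm s q * (C q x : ℂ)‖ ≤
      (1 / ((q.1.1 : ℕ) : ℝ) ^ s.re * (1 / ((q.1.2 : ℕ) : ℝ) ^ s.re) *
      (1 / ((q.2 : ℕ) : ℝ) ^ s.re)) * 8 := by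
    intro q x
    rw [norm_mul, norm_tripleTerm, Complex.norm_real]
    exact mul_le_mul_of_nonneg_left (hC8 q x) (by positivity)
  have hsumm := (summable_pnat_triple hs).mul_right 8
  have hcube : ∀ x : ℝ, HasSum (fun q => tripleTerm s q * (C q x : ℂ))
      ((2 * HurwitzZeta.cosZeta x s) ^ 3) := by
    intro x
    have h3 := hasSum_pow_three (hasSum_pnat_cosZeta x hs)
    refine h3.congr_fun fun q => ?_
    simp only [tripleTerm, hC]
    push_cast
    ring
  have hint := intervalIntegral.hasSum_integral_of_dominated_convergence
    (μ := volume) (a := 0) (b := 1 / 2) (F := fun q x => tripleTerm s q * (C q x : ℂ))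
    (f := fun x : ℝ => (2 * HurwitzZeta.cosZeta x s) ^ 3)
    (fun q _ => (1 / ((q.1.1 : ℕ) : ℝ) ^ s.re * (1 / ((q.1.2 : ℕ) : ℝ) ^ s.re) *
      (1 / ((q.2 : ℕ) : ℝ) ^ s.re)) * 8)
    (fun q => (by fun_prop : Continuous _).aestronglyMeasurable)
    (fun q => Eventually.of_forall fun x _ => hbound q x)
    (Eventually.of_forall fun x _ => hsumm) intervalIntegrable_const
    (Eventually.of_forall fun x _ => hcube x)
  refine hint.unique ?_
  have hval : ∀ q, ∫ x in (0 : ℝ)..1 / 2, tripleTerm s q * (C q x : ℂ) =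
      (tripleTerm s q * if q.2 = q.1.1 + q.1.2 then 1 else 0) +
      (tripleTerm s q * if q.1.2 = q.1.1 + q.2 then 1 else 0) +
      (tripleTerm s q * if q.1.1 = q.1.2 + q.2 then 1 else 0) := by
    intro q
    rw [intervalIntegral.integral_const_mul, intervalIntegral.integral_ofReal,
      integral_cos_mul_cos_mul_cos]
    push_cast [apply_ite ((↑) : ℝ → ℂ)]
    ring
  simp_rw [hval]
  rw [show 3 * wittenSeries s = wittenSeries s + wittenSeries s + wittenSeries s by ring]
  refine ((hasSum_tripleTerm_ite s hs (fun p => (p, p.1 + p.2)) ?_ _ ?_ ?_).add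
    (hasSum_tripleTerm_ite s hs (fun p => ((p.1, p.1 + p.2), p.2)) ?_ _ ?_ ?_)).add
    (hasSum_tripleTerm_ite s hs (fun p => ((p.1 + p.2, p.1), p.2)) ?_ _ ?_ ?_)
  · exact fun p q h => (Prod.mk.inj h).1
  · rintro ⟨⟨a, b⟩, c⟩
    simp [eq_comm]
  · exact fun p => rfl
  · rintro ⟨a, b⟩ ⟨c, d⟩ h
    simp only [Prod.mk.injEq] at h
    exact Prod.ext h.1.1 h.2
  · rintro ⟨⟨a, b⟩, c⟩
    simp [eq_comm]
  · intro p
    simp only [tripleTerm]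
    ring
  · rintro ⟨a, b⟩ ⟨c, d⟩ h
    simp only [Prod.mk.injEq] at h
    exact Prod.ext h.1.2 h.2
  · rintro ⟨⟨a, b⟩, c⟩
    simp [eq_comm]
  · intro p
    simp only [tripleTerm]
    ring

lemma differentiableOn_wittenSeries : DifferentiableOn ℂ wittenSeries {s | 1 < s.re} := by
  intro s hs
  obtain ⟨r, hr1, hr⟩ := exists_between (show 1 < s.re from hs)
  have hu : Summable fun p : ℕ+ × ℕ+ => 1 / ((p.1 : ℕ) : ℝ) ^ r * (1 / ((p.2 : ℕ) : ℝ) ^ r) :=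
    (summable_pnat_rpow hr1).mul_of_nonneg (summable_pnat_rpow hr1) (fun _ => by positivity)
      fun _ => by positivity
  have hopen : IsOpen {s : ℂ | r < s.re} := isOpen_lt continuous_const Complex.continuous_re
  refine DifferentiableAt.differentiableWithinAt ?_
  refine (differentiableOn_tsum_of_summable_norm hu (fun p => ?_) hopen
    (fun p z hz => ?_)).differentiableAt (hopen.mem_nhds hr)
  · simp_rw [← tripleTerm_add_eq]
    intro z _
    refine DifferentiableAt.differentiableWithinAt ?_
    have h : ∀ n : ℕ+, DifferentiableAt ℂ (fun z : ℂ => 1 / ((n : ℕ) : ℂ) ^ z) z := by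
      intro n
      have hn : ((n : ℕ) : ℂ) ≠ 0 := by exact_mod_cast n.ne_zero
      refine (differentiableAt_const _).div (differentiableAt_id.const_cpow (Or.inl hn)) ?_
      simp [cpow_eq_zero_iff, hn]
    exact ((h _).mul (h _)).mul (h _)
  · have hz' : r ≤ z.re := le_of_lt hz
    rw [← tripleTerm_add_eq, norm_tripleTerm]
    have h : ∀ n : ℕ+, 1 / ((n : ℕ) : ℝ) ^ z.re ≤ 1 / ((n : ℕ) : ℝ) ^ r := by
      intro n
      have hn : (1 : ℝ) ≤ ((n : ℕ) : ℝ) := by exact_mod_cast n.pos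
      exact one_div_le_one_div_of_le (by positivity) (Real.rpow_le_rpow_of_exponent_le hn hz')
    have h1 : ∀ n : ℕ+, 1 / ((n : ℕ) : ℝ) ^ z.re ≤ 1 := by
      intro n
      have hn : (1 : ℝ) ≤ ((n : ℕ) : ℝ) := by exact_mod_cast n.pos
      refine (div_le_one (by positivity)).2 (Real.one_le_rpow hn (by linarith))
    refine (mul_le_of_le_one_right (by positivity) (h1 _)).trans ?_
    exact mul_le_mul (h _) (h _) (by positivity) (by positivity)

end CosineIntegral

section IntegralEvaluation

open Topology MeasureTheory

/-- The power series with coefficients `c k s` in the variable `(2 * x) ^ 2`. -/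
noncomputable def coeffSeries (c : ℕ → ℂ → ℂ) (s : ℂ) (x : ℝ) : ℂ :=
  ∑' k, c k s * ((4 * x ^ 2 : ℝ) : ℂ) ^ k

lemma norm_four_mul_sq_le_one {x : ℝ} (hx : x ∈ Set.Icc (0 : ℝ) (1 / 2)) :
    ‖((4 * x ^ 2 : ℝ) : ℂ)‖ ≤ 1 := by
  obtain ⟨h0, h1⟩ := hx
  rw [Complex.norm_real, Real.norm_of_nonneg (by positivity)]
  nlinarith

lemma norm_mul_four_mul_sq_pow_le (z : ℂ) (k : ℕ) {x : ℝ} (hx : x ∈ Set.Icc (0 : ℝ) (1 / 2)) :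
    ‖z * ((4 * x ^ 2 : ℝ) : ℂ) ^ k‖ ≤ ‖z‖ := by
  rw [norm_mul, norm_pow]
  exact mul_le_of_le_one_right (norm_nonneg _)
    (pow_le_one₀ (norm_nonneg _) (norm_four_mul_sq_le_one hx))

lemma continuousOn_coeffSeries {c : ℕ → ℂ → ℂ} (hc : LocallyDominated c) (s : ℂ) :
    ContinuousOn (coeffSeries c s) (Set.Icc 0 (1 / 2)) :=
  continuousOn_tsum (fun k => by fun_prop) (hc.summable_norm s)
    fun k _ hx => norm_mul_four_mul_sq_pow_le _ k hx

lemma integral_cpow_mul_coeffSeries {c : ℕ → ℂ → ℂ} (hc : LocallyDominated c) (s : ℂ) {a : ℂ}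
    (ha : 0 ≤ a.re) :
    ∫ x in (0 : ℝ)..1 / 2, (x : ℂ) ^ a * coeffSeries c s x =
      2 ^ (-(a + 1)) * ∑' k : ℕ, c k s / (a + 1 + 2 * k) := by
  have hpos : ∀ k : ℕ, -1 < (a + 2 * k).re := by
    intro k
    simp
    linarith [(k.cast_nonneg : (0 : ℝ) ≤ k)]
  have hmono : ∀ (k : ℕ) (x : ℝ), x ∈ Set.Ioc (0 : ℝ) (1 / 2) →
      (x : ℂ) ^ a * (c k s * ((4 * x ^ 2 : ℝ) : ℂ) ^ k) =
        (c k s * 4 ^ k) * (x : ℂ) ^ (a + 2 * k) := by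
    intro k x hx
    have hx0 : (x : ℂ) ≠ 0 := by exact_mod_cast hx.1.ne'
    rw [cpow_add _ _ hx0, show (2 * k : ℂ) = ((2 * k : ℕ) : ℂ) by push_cast; rfl, cpow_natCast,
      pow_mul]
    push_cast
    ring
  have hint := intervalIntegral.hasSum_integral_of_dominated_convergence
    (μ := volume) (a := 0) (b := 1 / 2)
    (F := fun (k : ℕ) (x : ℝ) => (c k s * 4 ^ k) * (x : ℂ) ^ (a + 2 * k))
    (f := fun x : ℝ => (x : ℂ) ^ a * coeffSeries c s x)
    (fun k _ => ‖c k s‖) (fun k => ?_) (fun k => Eventually.of_forall fun x hx => ?_)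
    (Eventually.of_forall fun x _ => hc.summable_norm s) intervalIntegrable_const
    (Eventually.of_forall fun x hx => ?_)
  · rw [← hint.tsum_eq, ← tsum_mul_left]
    refine tsum_congr fun k => ?_
    have hne : a + 2 * k + 1 ≠ 0 := by
      intro h
      have h1 := congrArg Complex.re h
      have h2 := hpos k
      simp only [add_re, one_re, zero_re] at h1 h2
      linarith
    rw [intervalIntegral.integral_const_mul, integral_cpow (Or.inl (hpos k)), ofReal_zero,
      zero_cpow hne, sub_zero, show a + 2 * k + 1 = (a + 1) + ((2 * k : ℕ) : ℂ) by push_cast; ring]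
    have h2 : ((1 / 2 : ℝ) : ℂ) = (2 : ℂ)⁻¹ := by push_cast; ring
    have h3 : ((2 : ℂ)⁻¹) ^ (a + 1) = 2 ^ (-(a + 1)) := by
      rw [← h2, cpow_neg, show (2 : ℂ) = ((2 : ℝ) : ℂ) by push_cast; rfl,
        ← inv_cpow _ _ (by rw [arg_ofReal_of_nonneg (by norm_num)]; exact Real.pi_pos.ne)]
      push_cast
      norm_num
    rw [h2, cpow_add _ _ (by norm_num), cpow_natCast, h3, pow_mul, inv_pow]
    push_cast
    have h4 : (4 : ℂ) ^ k * ((2 ^ 2)⁻¹) ^ k = 1 := by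
      rw [← mul_pow]
      norm_num
    linear_combination (c k s * 2 ^ (-(a + 1)) / (a + 1 + 2 * k)) * h4
  · refine Measurable.aestronglyMeasurable ?_
    exact (Complex.measurable_ofReal.pow_const _).const_mul _
  · rw [Set.uIoc_of_le (by norm_num)] at hx
    rw [← hmono k x hx, norm_mul]
    refine (mul_le_of_le_one_left (norm_nonneg _) ?_).trans
      (norm_mul_four_mul_sq_pow_le _ k ⟨hx.1.le, hx.2⟩)
    rw [norm_cpow_eq_rpow_re_of_pos hx.1]
    exact Real.rpow_le_one hx.1.le (by linarith [hx.2]) ha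
  · rw [Set.uIoc_of_le (by norm_num)] at hx
    have h1 : Summable fun k => c k s * ((4 * x ^ 2 : ℝ) : ℂ) ^ k :=
      (hc.summable_norm s).of_norm_bounded fun k =>
        norm_mul_four_mul_sq_pow_le _ k ⟨hx.1.le, hx.2⟩
    exact (h1.hasSum.mul_left _).congr_fun fun k => (hmono k x hx).symm

/-- The Cauchy square of the sequence `evenCoeff`. -/
noncomputable def evenCoeffSq : ℕ → ℂ → ℂ := cauchyProduct evenCoeff evenCoeff

/-- The Cauchy cube of the sequence `evenCoeff`. -/
noncomputable def evenCoeffCube : ℕ → ℂ → ℂ := cauchyProduct evenCoeffSq evenCoeff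

lemma locallyDominated_evenCoeffSq : LocallyDominated evenCoeffSq :=
  locallyDominated_evenCoeff.cauchyProduct locallyDominated_evenCoeff

lemma locallyDominated_evenCoeffCube : LocallyDominated evenCoeffCube :=
  locallyDominated_evenCoeffSq.cauchyProduct locallyDominated_evenCoeff

/-- Closed form of `∫ x in 0..1/2, (2 * ζ_even(x, 1 - s)) ^ 3`. -/
noncomputable def cubeIntegral (s : ℂ) : ℂ :=
  2 ^ (2 - 3 * s) / (3 * s - 2) - 3 / s * (2 ^ (1 - 2 * s) * mellinSeries evenCoeff
    (fun s => 2 * s - 1) s) + 3 / s ^ 2 * (2 ^ (-s) * mellinSeries evenCoeffSq (fun s => s) s) -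
    1 / s ^ 3 * (2⁻¹ * mellinSeries evenCoeffCube (fun _ => 1) s)

lemma integral_hurwitzZetaEven_pow_three {s : ℂ} (hs : 1 < s.re) :
    ∫ x in (0 : ℝ)..1 / 2, (2 * HurwitzZeta.hurwitzZetaEven x (1 - s)) ^ 3 = cubeIntegral s := by
  have hs0 : s ≠ 0 := by
    rintro rfl
    norm_num at hs
  have hpoint : ∀ x ∈ Set.Ioc (0 : ℝ) (1 / 2), (2 * HurwitzZeta.hurwitzZetaEven x (1 - s)) ^ 3 =
      (x : ℂ) ^ (3 * s - 3) - 3 / s * ((x : ℂ) ^ (2 * s - 2) * coeffSeries evenCoeff s x) +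
      3 / s ^ 2 * ((x : ℂ) ^ (s - 1) * coeffSeries evenCoeffSq s x) -
      1 / s ^ 3 * ((x : ℂ) ^ (0 : ℂ) * coeffSeries evenCoeffCube s x) := by
    intro x hx
    have hx' : x ∈ Set.Icc (0 : ℝ) (1 / 2) := ⟨hx.1.le, hx.2⟩
    have h1 : coeffSeries evenCoeff s x = _ := tsum_evenCoeff_eq hx.1 hx.2 hs0
    have h2 : coeffSeries evenCoeffSq s x = _ := tsum_cauchyProduct_mul_pow
      locallyDominated_evenCoeff locallyDominated_evenCoeff s (norm_four_mul_sq_le_one hx')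
    have h3 : coeffSeries evenCoeffCube s x = _ := tsum_cauchyProduct_mul_pow
      locallyDominated_evenCoeffSq locallyDominated_evenCoeff s (norm_four_mul_sq_le_one hx')
    change _ = coeffSeries evenCoeff s x * coeffSeries evenCoeff s x at h2
    change _ = coeffSeries evenCoeffSq s x * coeffSeries evenCoeff s x at h3
    have h4 : 2 * HurwitzZeta.hurwitzZetaEven x (1 - s) =
        (x : ℂ) ^ (s - 1) - 1 / s * coeffSeries evenCoeff s x := by
      rw [h1]
      field_simp
      ring
    have h5 : (x : ℂ) ^ (2 * s - 2) = ((x : ℂ) ^ (s - 1)) ^ 2 := by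
      rw [← cpow_nat_mul]; congr 1; push_cast; ring
    have h6 : (x : ℂ) ^ (3 * s - 3) = ((x : ℂ) ^ (s - 1)) ^ 3 := by
      rw [← cpow_nat_mul]; congr 1; push_cast; ring
    rw [h4, h3, h2, h5, h6, cpow_zero]
    ring
  have hII : ∀ {f : ℝ → ℂ}, ContinuousOn f (Set.Icc 0 (1 / 2)) →
      IntervalIntegrable f volume 0 (1 / 2) := fun hf =>
    ContinuousOn.intervalIntegrable (by rwa [Set.uIcc_of_le (by norm_num)])
  have hcont : ∀ {a : ℂ}, 0 < a.re → Continuous fun x : ℝ => (x : ℂ) ^ a :=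
    fun h => continuous_ofReal_cpow_const h
  have i0 : IntervalIntegrable (fun x : ℝ => (x : ℂ) ^ (3 * s - 3)) volume 0 (1 / 2) :=
    (hcont (by simp; linarith)).intervalIntegrable _ _
  have i1 := (hII ((hcont (a := 2 * s - 2) (by simp; linarith)).continuousOn.mul
    (continuousOn_coeffSeries locallyDominated_evenCoeff s))).const_mul (3 / s)
  have i2 := (hII ((hcont (a := s - 1) (by simp; linarith)).continuousOn.mul
    (continuousOn_coeffSeries locallyDominated_evenCoeffSq s))).const_mul (3 / s ^ 2)
  have i3 := (hII (ContinuousOn.mul (f := fun x : ℝ => (x : ℂ) ^ (0 : ℂ)) (by simp only [cpow_zero]; fun_prop)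
    (continuousOn_coeffSeries locallyDominated_evenCoeffCube s))).const_mul (1 / s ^ 3)
  simp only [Pi.mul_apply] at i1 i2 i3
  rw [intervalIntegral.integral_congr_ae (Eventually.of_forall fun x hx => hpoint x (by
      rwa [Set.uIoc_of_le (by norm_num)] at hx)),
    intervalIntegral.integral_sub ((i0.sub i1).add i2) i3,
    intervalIntegral.integral_add (i0.sub i1) i2, intervalIntegral.integral_sub i0 i1]
  simp only [intervalIntegral.integral_const_mul]
  rw [integral_cpow_mul_coeffSeries locallyDominated_evenCoeff s (by simp; linarith),
    integral_cpow_mul_coeffSeries locallyDominated_evenCoeffSq s (by simp; linarith),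
    integral_cpow_mul_coeffSeries locallyDominated_evenCoeffCube s (by simp),
    integral_cpow (Or.inl (by simp; linarith))]
  have hne : 3 * s - 3 + 1 ≠ 0 := by
    intro h
    have h1 := congrArg Complex.re h
    simp at h1
    linarith
  have h2 : ((1 / 2 : ℝ) : ℂ) ^ (3 * s - 3 + 1) = 2 ^ (2 - 3 * s) := by
    rw [show 2 - 3 * s = -(3 * s - 3 + 1) by ring, cpow_neg,
      show (2 : ℂ) = ((2 : ℝ) : ℂ) by push_cast; rfl,
      ← inv_cpow _ _ (by rw [arg_ofReal_of_nonneg (by norm_num)]; exact Real.pi_pos.ne)]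
    push_cast
    norm_num
  rw [h2, ofReal_zero, zero_cpow hne, sub_zero, cubeIntegral, mellinSeries, mellinSeries,
    mellinSeries]
  simp only [zero_add, cpow_neg_one]
  rw [show 2 * s - 2 + 1 = 2 * s - 1 by ring, show -(2 * s - 1) = 1 - 2 * s by ring,
    show s - 1 + 1 = s by ring, show 3 * s - 3 + 1 = 3 * s - 2 by ring]

/-- The factor relating the periodic zeta function at `s` to the Hurwitz zeta function at
`1 - s`. -/
noncomputable def reflectionFactor (s : ℂ) : ℂ :=
  2 * (2 * Real.pi) ^ (s - 1) * Gamma (1 - s) * cos (Real.pi * (1 - s) / 2)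

lemma wittenSeries_eq {s : ℂ} (hs : 1 < s.re) (hn : ∀ n : ℕ, s ≠ n) :
    wittenSeries s = 1 / 3 * reflectionFactor s ^ 3 * cubeIntegral s := by
  have h := integral_cosZeta_pow_three hs
  have h1 : ∀ x : ℝ, (2 * HurwitzZeta.cosZeta x s) ^ 3 =
      reflectionFactor s ^ 3 * (2 * HurwitzZeta.hurwitzZetaEven x (1 - s)) ^ 3 := by
    intro x
    have h2 := HurwitzZeta.cosZeta_one_sub x (s := 1 - s) (fun n h => hn n (by
      linear_combination -h))
    rw [sub_sub_cancel, neg_sub] at h2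
    rw [h2, reflectionFactor]
    ring
  simp_rw [h1] at h
  rw [intervalIntegral.integral_const_mul, integral_hurwitzZetaEven_pow_three hs] at h
  linear_combination -h / 3

end IntegralEvaluation

section MeromorphicContinuation

open Topology

lemma MeromorphicNFAt.deriv_of_tendsto_div_sq {F : ℂ → ℂ} {z L : ℂ} (hF : MeromorphicNFAt F z)
    (h : Tendsto (fun s => F s / (s - z) ^ 2) (𝓝[≠] z) (𝓝 L)) :
    AnalyticAt ℂ F z ∧ F z = 0 ∧ deriv F z = 0 ∧ iteratedDeriv 2 F z = 2 * L := by
  have hG : MeromorphicAt (fun s => F s / (s - z) ^ 2) z := by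
    have := hF.meromorphicAt
    fun_prop
  set G := toMeromorphicNFAt (fun s => F s / (s - z) ^ 2) z
  have hGan : AnalyticAt ℂ G z := hG.meromorphicOrderAt_nonneg_iff_analyticAt_toMeromorphicNFAt.1
    ((tendsto_nhds_iff_meromorphicOrderAt_nonneg hG).1 ⟨L, h⟩)
  have hGeq := hG.eq_nhdsNE_toMeromorphicNFAt
  have hGz : G z = L := tendsto_nhds_unique
    (hGan.continuousAt.tendsto.mono_left nhdsWithin_le_nhds) (h.congr' hGeq)
  have hH : AnalyticAt ℂ (fun s => (s - z) ^ 2 * G s) z := by fun_prop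
  have hFH : F =ᶠ[𝓝 z] fun s => (s - z) ^ 2 * G s := by
    rw [← hF.eventuallyEq_nhdsNE_iff_eventuallyEq_nhds hH.meromorphicNFAt]
    filter_upwards [hGeq, self_mem_nhdsWithin] with s hs hsz
    rw [show G s = _ from hs.symm]
    field_simp [sub_ne_zero.2 (show s ≠ z from hsz)]
  have hd : deriv F =ᶠ[𝓝 z] fun s => (s - z) * (2 * G s + (s - z) * deriv G s) := by
    refine hFH.deriv.trans ?_
    filter_upwards [hGan.eventually_analyticAt] with s hs
    have h1 : HasDerivAt (fun s : ℂ => (s - z) ^ 2) (2 * (s - z)) s := by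
      simpa using ((hasDerivAt_id s).sub_const z).fun_pow 2
    rw [(h1.fun_mul hs.differentiableAt.hasDerivAt).deriv]
    ring
  refine ⟨hH.congr hFH.symm, by simp [hFH.eq_of_nhds], by simp [hd.eq_of_nhds], ?_⟩
  have h2 : HasDerivAt (fun s => (s - z) * (2 * G s + (s - z) * deriv G s)) (2 * L) z := by
    have hB : DifferentiableAt ℂ (fun s => 2 * G s + (s - z) * deriv G s) z := by
      have := hGan.deriv
      exact AnalyticAt.differentiableAt (by fun_prop)
    simpa [hGz] using ((hasDerivAt_id z).sub_const z).fun_mul hB.hasDerivAt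
  rw [iteratedDeriv_succ, iteratedDeriv_one, hd.deriv_eq, h2.deriv]

/-- The meromorphic continuation of `wittenSeries`, up to its values at isolated points. -/
noncomputable def wittenContinuation (s : ℂ) : ℂ :=
  1 / 3 * reflectionFactor s ^ 3 * cubeIntegral s

lemma meromorphicAt_reflectionFactor (z : ℂ) : MeromorphicAt reflectionFactor z := by
  have h1 : MeromorphicAt (fun s : ℂ => Gamma (1 - s)) z :=
    (Meromorphic.Gamma (1 - z)).comp_analyticAt (g := fun s : ℂ => 1 - s) (by fun_prop)
  have h2 : MeromorphicAt (fun s : ℂ => (2 * Real.pi : ℂ) ^ (s - 1)) z := by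
    refine AnalyticAt.meromorphicAt (Differentiable.analyticAt (fun s => ?_) z)
    exact DifferentiableAt.const_cpow (by fun_prop) (Or.inl (by simp [Real.pi_ne_zero]))
  have h3 : MeromorphicAt (fun s : ℂ => cos (Real.pi * (1 - s) / 2)) z := by
    exact AnalyticAt.meromorphicAt (Differentiable.analyticAt (by fun_prop) z)
  unfold reflectionFactor
  fun_prop

lemma meromorphicAt_cubeIntegral (z : ℂ) : MeromorphicAt cubeIntegral z := by
  have h1 := meromorphicAt_mellinSeries locallyDominated_evenCoeff
    (l := fun s => 2 * s - 1) (by fun_prop) z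
  have h2 := meromorphicAt_mellinSeries locallyDominated_evenCoeffSq
    (l := fun s => s) (by fun_prop) z
  have h3 := meromorphicAt_mellinSeries locallyDominated_evenCoeffCube
    (l := fun _ => 1) (by fun_prop) z
  have h4 : ∀ a b : ℂ, MeromorphicAt (fun s : ℂ => (2 : ℂ) ^ (a + b * s)) z := fun a b =>
    AnalyticAt.meromorphicAt (Differentiable.analyticAt (fun s =>
      DifferentiableAt.const_cpow (by fun_prop) (Or.inl two_ne_zero)) z)
  have h5 : MeromorphicAt (fun s : ℂ => (2 : ℂ) ^ (2 - 3 * s)) z := by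
    simpa [sub_eq_add_neg] using h4 2 (-3)
  have h6 : MeromorphicAt (fun s : ℂ => (2 : ℂ) ^ (1 - 2 * s)) z := by
    simpa [sub_eq_add_neg] using h4 1 (-2)
  have h7 : MeromorphicAt (fun s : ℂ => (2 : ℂ) ^ (-s)) z := by
    simpa using h4 0 (-1)
  unfold cubeIntegral
  generalize mellinSeries evenCoeff (fun s => 2 * s - 1) = f at h1 ⊢
  generalize mellinSeries evenCoeffSq (fun s => s) = g at h2 ⊢
  generalize mellinSeries evenCoeffCube (fun _ => 1) = k at h3 ⊢
  fun_prop

lemma meromorphicAt_wittenContinuation (z : ℂ) : MeromorphicAt wittenContinuation z := by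
  have h1 := meromorphicAt_reflectionFactor z
  have h2 := meromorphicAt_cubeIntegral z
  unfold wittenContinuation
  fun_prop

lemma wittenContinuation_eventuallyEq {z : ℂ} (hz : 1 < z.re) :
    wittenContinuation =ᶠ[𝓝[≠] z] wittenSeries := by
  have h1 : ∀ᶠ s in 𝓝[≠] z, 1 < s.re :=
    eventually_nhdsWithin_of_eventually_nhds
      ((isOpen_lt continuous_const Complex.continuous_re).mem_nhds hz)
  have h2 : ∀ᶠ s in 𝓝[≠] z, ∀ n : ℕ, s ≠ (n : ℂ) := by
    have hcl : IsClosed ((fun n : ℕ => (n : ℂ)) '' {n | (n : ℂ) ≠ z}) := by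
      have : IsClosedEmbedding (fun n : ℕ => (n : ℂ)) := by
        simpa [Function.comp_def] using
          Complex.isometry_ofReal.isClosedEmbedding.comp Nat.isClosedEmbedding_coe_real
      exact this.isClosedMap _ (isClosed_discrete _)
    have h3 : ((fun n : ℕ => (n : ℂ)) '' {n | (n : ℂ) ≠ z})ᶜ ∈ 𝓝 z :=
      hcl.isOpen_compl.mem_nhds (by rintro ⟨n, hn, h⟩; exact hn h)
    filter_upwards [nhdsWithin_le_nhds h3, self_mem_nhdsWithin] with s hs hsz n hn
    exact hs ⟨n, by exact fun h => hsz (hn.trans h), hn.symm⟩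
  filter_upwards [h1, h2] with s hs1 hs2
  rw [wittenSeries_eq hs1 hs2, wittenContinuation]

end MeromorphicContinuation

section NegativeEvenIntegers

open Finset Topology

lemma tendsto_reflectionFactor_div {m n : ℕ} (h : m = 2 * n) :
    Tendsto (fun s : ℂ => reflectionFactor s / (s - -(m : ℂ))) (𝓝[≠] (-(m : ℂ)))
      (𝓝 ((-1) ^ n * m.factorial / (2 * (2 * Real.pi) ^ m))) := by
  have h1 : HasDerivAt (fun s : ℂ => cos (Real.pi * (1 - s) / 2)) ((-1) ^ n * (Real.pi / 2))
      (-(m : ℂ)) := by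
    have h2 : HasDerivAt (fun s : ℂ => Real.pi * (1 - s) / 2) (-(Real.pi / 2 : ℂ)) (-(m : ℂ)) := by
      have := (((hasDerivAt_id (-(m : ℂ))).const_sub 1).const_mul (Real.pi : ℂ)).div_const 2
      refine this.congr_deriv ?_
      ring
    refine h2.ccos.congr_deriv ?_
    have h3 : (Real.pi * (1 - -(m : ℂ)) / 2 : ℂ) = Real.pi / 2 + n * Real.pi := by
      rw [h]; push_cast; ring
    rw [h3, Complex.sin_antiperiodic.add_nat_mul_eq, Complex.sin_pi_div_two]
    ring
  have h0 : cos (Real.pi * (1 - -(m : ℂ)) / 2) = 0 := by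
    have h3 : (Real.pi * (1 - -(m : ℂ)) / 2 : ℂ) = Real.pi / 2 + n * Real.pi := by
      rw [h]; push_cast; ring
    rw [h3, Complex.cos_antiperiodic.add_nat_mul_eq, Complex.cos_pi_div_two, mul_zero]
  have hslope := hasDerivAt_iff_tendsto_slope.1 h1
  have hΓ : ContinuousAt (fun s : ℂ => Gamma (1 - s)) (-(m : ℂ)) := by
    have hd : DifferentiableAt ℂ Gamma (1 - -(m : ℂ)) := by
      refine Complex.differentiableAt_Gamma _ fun k hk => ?_
      have : ((1 + m + k : ℕ) : ℂ) = 0 := by push_cast; linear_combination hk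
      exact absurd (Nat.cast_eq_zero.1 this) (by omega)
    exact ContinuousAt.comp (f := fun s : ℂ => 1 - s) hd.continuousAt (by fun_prop)
  have hπ : ContinuousAt (fun s : ℂ => (2 * Real.pi : ℂ) ^ (s - 1)) (-(m : ℂ)) :=
    (DifferentiableAt.const_cpow (by fun_prop)
      (Or.inl (by simp [Real.pi_ne_zero]))).continuousAt
  have hlim := (((hπ.const_mul 2).mul hΓ).tendsto.mono_left nhdsWithin_le_nhds).mul hslope
  have hval : (2 * (2 * Real.pi : ℂ) ^ (-(m : ℂ) - 1) * Gamma (1 - -(m : ℂ)) *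
      ((-1) ^ n * (Real.pi / 2))) = (-1) ^ n * m.factorial / (2 * (2 * Real.pi) ^ m) := by
    have hp : (2 * Real.pi : ℂ) ≠ 0 := by simp [Real.pi_ne_zero]
    have hp' : (Real.pi : ℂ) ≠ 0 := by simp [Real.pi_ne_zero]
    rw [show (-(m : ℂ) - 1) = -((m + 1 : ℕ) : ℂ) by push_cast; ring, cpow_neg, cpow_natCast,
      show (1 - -(m : ℂ)) = m + 1 by ring, Complex.Gamma_nat_eq_factorial, pow_succ]
    field_simp
  rw [← hval]
  refine hlim.congr' ?_
  filter_upwards with s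
  simp only [Pi.mul_apply]
  rw [slope_def_field, h0, reflectionFactor]
  ring

lemma prod_add_div_mul (m r : ℕ) :
    (∏ j ∈ range r, ((j : ℂ) + m) / (j + 1)) * (m + r) = m * (m + r).choose r := by
  induction r with
  | zero => simp
  | succ r ih =>
    have h := congrArg (Nat.cast : ℕ → ℂ) (Nat.add_one_mul_choose_eq (m + r) r)
    push_cast at h
    have hr : (r + 1 : ℂ) ≠ 0 := by exact_mod_cast r.succ_ne_zero
    rw [prod_range_succ, ← add_assoc m r 1]
    refine mul_right_cancel₀ hr ?_
    push_cast
    field_simp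
    linear_combination (m + r + 1 : ℂ) * ih + (m : ℂ) * h

lemma evenCoeff_neg_nat {m : ℕ} (hm : 0 < m) (i : ℕ) : evenCoeff i (-(m : ℂ)) =
    2 * m * ((m + 2 * i).choose (2 * i) * riemannZeta ((1 + m + 2 * i : ℕ) : ℂ)) *
      (1 / 4) ^ i := by
  have h1 : (1 - -(m : ℂ) + 2 * i) = ((1 + m + 2 * i : ℕ) : ℂ) := by push_cast; ring
  have h2 := prod_add_div_mul m (2 * i)
  rw [evenCoeff, h1, zetaEntire_of_ne (by exact_mod_cast (by omega : 1 + m + 2 * i ≠ 1))]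
  simp_rw [sub_neg_eq_add]
  push_cast at h2 ⊢
  linear_combination 2 * riemannZeta (1 + m + 2 * i) * (1 / 4) ^ i * h2

lemma evenCoeffSq_neg_nat {m : ℕ} (hm : 0 < m) (n : ℕ) : evenCoeffSq n (-(m : ℂ)) =
    4 * m ^ 2 * (1 / 4) ^ n * ∑ p ∈ antidiagonal n, zetaConvTerm m (2 * p.1, 2 * p.2) := by
  rw [evenCoeffSq, cauchyProduct, mul_sum]
  refine sum_congr rfl fun p hp => ?_
  rw [evenCoeff_neg_nat hm, evenCoeff_neg_nat hm, zetaConvTerm, ← mem_antidiagonal.1 hp, pow_add]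
  ring

lemma tendsto_mul_cubeIntegral {m n : ℕ} (hm : 0 < m) (h : m = 2 * n) :
    Tendsto (fun s : ℂ => (s - -(m : ℂ)) * cubeIntegral s) (𝓝[≠] (-(m : ℂ)))
      (𝓝 (12 * ∑ p ∈ antidiagonal n, zetaConvTerm m (2 * p.1, 2 * p.2))) := by
  have hm0 : (m : ℂ) ≠ 0 := Nat.cast_ne_zero.2 hm.ne'
  have hz : -(m : ℂ) ≠ 0 := neg_ne_zero.2 hm0
  have hpow : ∀ l : ℂ → ℂ, Differentiable ℂ l →
      ContinuousAt (fun s : ℂ => (2 : ℂ) ^ l s) (-(m : ℂ)) := fun l hl =>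
    (DifferentiableAt.const_cpow hl.differentiableAt (Or.inl two_ne_zero)).continuousAt
  have h1 : ContinuousAt (mellinSeries evenCoeff fun s => 2 * s - 1) (-(m : ℂ)) := by
    refine (analyticAt_mellinSeries locallyDominated_evenCoeff (by fun_prop)
      fun k hk => ?_).continuousAt
    have h2 : ((2 * k : ℤ) : ℂ) = ((2 * m + 1 : ℤ) : ℂ) := by
      push_cast; linear_combination hk
    have h3 := Int.cast_injective h2
    omega
  have h3 : ContinuousAt (mellinSeries evenCoeffCube fun _ => 1) (-(m : ℂ)) := by
    refine (analyticAt_mellinSeries locallyDominated_evenCoeffCube (by fun_prop)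
      fun k hk => ?_).continuousAt
    have h2 : ((1 + 2 * k : ℕ) : ℂ) = 0 := by push_cast; exact hk
    exact absurd (Nat.cast_eq_zero.1 h2) (by omega)
  have h4 : 3 * (-(m : ℂ)) - 2 ≠ 0 := by
    intro h0
    have h2 : ((3 * m + 2 : ℕ) : ℂ) = 0 := by push_cast; linear_combination -h0
    exact absurd (Nat.cast_eq_zero.1 h2) (by omega)
  have hreg : ContinuousAt (fun s : ℂ => (s - -(m : ℂ)) * (2 ^ (2 - 3 * s) / (3 * s - 2) -
      3 / s * (2 ^ (1 - 2 * s) * mellinSeries evenCoeff (fun s => 2 * s - 1) s) -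
      1 / s ^ 3 * (2⁻¹ * mellinSeries evenCoeffCube (fun _ => 1) s))) (-(m : ℂ)) := by
    have h5 := hpow (fun s => 2 - 3 * s) (by fun_prop)
    have h6 := hpow (fun s => 1 - 2 * s) (by fun_prop)
    have h7 : (-(m : ℂ)) ^ 3 ≠ 0 := pow_ne_zero _ hz
    fun_prop (disch := assumption)
  have hsing : ContinuousAt (fun s : ℂ => 3 / s ^ 2 * 2 ^ (-s)) (-(m : ℂ)) := by
    have h5 := hpow (fun s => -s) (by fun_prop)
    have h7 : (-(m : ℂ)) ^ 2 ≠ 0 := pow_ne_zero _ hz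
    fun_prop (disch := assumption)
  have hlim := ((hsing.tendsto.mono_left nhdsWithin_le_nhds).mul
    (tendsto_sub_mul_mellinSeries locallyDominated_evenCoeffSq n
      (z := -(m : ℂ)) (by rw [h]; push_cast; ring))).add
    (hreg.tendsto.mono_left nhdsWithin_le_nhds)
  have hval : 12 * ∑ p ∈ antidiagonal n, zetaConvTerm m (2 * p.1, 2 * p.2) =
      3 / (-(m : ℂ)) ^ 2 * 2 ^ (- -(m : ℂ)) * evenCoeffSq n (-(m : ℂ)) := by
    have h2 : (2 : ℂ) ^ m * (1 / 4) ^ n = 1 := by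
      rw [h, pow_mul, ← mul_pow]; norm_num
    rw [evenCoeffSq_neg_nat hm, neg_neg, cpow_natCast]
    field_simp
    linear_combination (-12 : ℂ) * (∑ p ∈ antidiagonal n, zetaConvTerm m (2 * p.1, 2 * p.2)) * h2
  rw [sub_self, zero_mul, add_zero] at hlim
  rw [hval]
  refine hlim.congr' ?_
  filter_upwards with s
  rw [cubeIntegral]
  ring

lemma tendsto_wittenContinuation_div_sq {m n : ℕ} (hm : 0 < m) (h : m = 2 * n) :
    Tendsto (fun s : ℂ => wittenContinuation s / (s - -(m : ℂ)) ^ 2) (𝓝[≠] (-(m : ℂ)))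
      (𝓝 (1 / 3 * ((-1) ^ n * m.factorial / (2 * (2 * Real.pi) ^ m)) ^ 3 *
        (12 * ∑ p ∈ antidiagonal n, zetaConvTerm m (2 * p.1, 2 * p.2)))) := by
  refine ((((tendsto_reflectionFactor_div h).pow 3).const_mul (1 / 3)).mul
    (tendsto_mul_cubeIntegral hm h)).congr' ?_
  filter_upwards [self_mem_nhdsWithin] with s hs
  have hs' : s - -(m : ℂ) ≠ 0 := sub_ne_zero.2 hs
  rw [wittenContinuation]
  field_simp

end NegativeEvenIntegers

/-- Onodera's formula: the normalized Witten zeta function of `A₂`,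
`ξ(s) = Σ_{m₁,m₂≥1} (m₁m₂(m₁+m₂))^{-s}`, continues meromorphically, has a zero of order at
least `2` at every negative even integer `-m`, and its second derivative there is given by
`((2π)^{3m}/(m!)³) ξ''(-m) = ((-1)^{m/2}/3) [Σ_{j=0}^m C(m+j,j)C(2m-j,m-j)ζ(1+m+j)ζ(1+2m-j)(1+2(-1)^j)
  + (1/2)C(3m+1,2m+1)ζ(3m+2)]`. -/
theorem stmt_9 :
    ∃ F : ℂ → ℂ,
      (∀ z : ℂ, MeromorphicAt F z) ∧
      (∀ s : ℂ, 1 < s.re →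
        F s = ∑' p : ℕ+ × ℕ+, 1 / (((p.1 : ℕ) : ℂ) * ((p.2 : ℕ) : ℂ) *
          (((p.1 : ℕ) : ℂ) + ((p.2 : ℕ) : ℂ))) ^ s) ∧
      (∀ m : ℕ, 0 < m → Even m →
        AnalyticAt ℂ F (-(m : ℂ)) ∧ F (-(m : ℂ)) = 0 ∧ deriv F (-(m : ℂ)) = 0 ∧
        (((2 * Real.pi : ℝ) ^ (3 * m) : ℂ) / ((Nat.factorial m : ℂ)) ^ 3) *
            iteratedDeriv 2 F (-(m : ℂ)) =
          ((-1 : ℂ) ^ (m / 2) / 3) *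
            ((∑ j ∈ Finset.range (m + 1),
                (Nat.choose (m + j) j : ℂ) * (Nat.choose (2 * m - j) (m - j) : ℂ) *
                  riemannZeta ((1 + m + j : ℕ) : ℂ) * riemannZeta ((1 + 2 * m - j : ℕ) : ℂ) *
                  (1 + 2 * (-1 : ℂ) ^ j)) +
              (1 / 2) * (Nat.choose (3 * m + 1) (2 * m + 1) : ℂ) *
                riemannZeta ((3 * m + 2 : ℕ) : ℂ))) := by
  have hmer : MeromorphicOn wittenContinuation Set.univ := fun z _ =>
    meromorphicAt_wittenContinuation z
  set F := toMeromorphicNFOn wittenContinuation Set.univ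
  have hNF : ∀ z, MeromorphicNFAt F z := fun z =>
    meromorphicNFOn_toMeromorphicNFOn wittenContinuation Set.univ (Set.mem_univ z)
  have hF : ∀ z, F =ᶠ[nhdsWithin z {z}ᶜ] wittenContinuation := fun z =>
    hmer.toMeromorphicNFOn_eq_self_on_nhdsNE (Set.mem_univ z)
  refine ⟨F, fun z => (hNF z).meromorphicAt, fun s hs => ?_, fun m hm he => ?_⟩
  · have han : AnalyticAt ℂ wittenSeries s := differentiableOn_wittenSeries.analyticAt
      ((isOpen_lt continuous_const Complex.continuous_re).mem_nhds hs)
    exact (((hNF s).eventuallyEq_nhdsNE_iff_eventuallyEq_nhds han.meromorphicNFAt).1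
      ((hF s).trans (wittenContinuation_eventuallyEq hs))).eq_of_nhds
  · obtain ⟨n, hn⟩ := he.two_dvd
    obtain ⟨h1, h2, h3, h4⟩ := (hNF (-(m : ℂ))).deriv_of_tendsto_div_sq
      ((tendsto_wittenContinuation_div_sq hm hn).congr'
        ((hF _).mono fun s hs => by simp only [hs]))
    refine ⟨h1, h2, h3, ?_⟩
    rw [h4, sum_range_zetaConv m n hm hn, show m / 2 = n by omega]
    have hp : (Real.pi : ℂ) ≠ 0 := by simp [Real.pi_ne_zero]
    have hf : (m.factorial : ℂ) ≠ 0 := Nat.cast_ne_zero.2 m.factorial_ne_zero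
    have hsq : ((-1 : ℂ) ^ n) ^ 2 = 1 := by rw [← pow_mul, mul_comm, pow_mul]; simp
    push_cast
    rw [mul_comm 3 m, pow_mul]
    field_simp
    linear_combination
      (12 * ∑ p ∈ Finset.HasAntidiagonal.antidiagonal n, zetaConvTerm m (2 * p.1, 2 * p.2)) * hsq
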